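/- arXiv:2404.01245 — 9 statements merged into one kernel-verified Lean document; each statement's English description precedes it below -/
import Mathlib

section
/- Let V : (0,1] × (0,1) → ℝ ∪ {−∞} be such that V(p,·) is measurable for each p, and let U, U_1, U_2 be independent Uniform(0,1) random variables. Assume: (i) for all P_1, P_2 > 0 with P_1 + P_2 ≤ 1, P( V(P_1, U_1) ≥ V(P_2, U_2) ) = P_1/(P_1 + P_2); and (ii) for all such P_1, P_2, the random variable max{ V(P_1, U_1), V(P_2, U_2) } has the same distribution as V(P_1 + P_2, U). Then there exists a strictly increasing function g : (−∞, 0) → ℝ ∪ {−∞, +∞} such that for every p ∈ (0,1], V(p, U) has the same distribution as g( (log U)/p ). Conversely, if V(p,u) = g( (log u)/p ) for some strictly increasing g, then (i) and (ii) hold. -/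
open MeasureTheory
open scoped ENNReal

/-- The uniform distribution on `(0,1)`. -/
noncomputable def unifMeasure : Measure ℝ := volume.restrict (Set.Ioo 0 1)

/-- Two-token unbiasedness requirement: for independent `U₁, U₂ ~ Uniform(0,1)`,
`P(V(P₁,U₁) ≥ V(P₂,U₂)) = P₁/(P₁+P₂)` whenever `P₁, P₂ > 0` and `P₁+P₂ ≤ 1`. -/
def GumbelCondI (V : ℝ → ℝ → EReal) : Prop :=
  ∀ P₁ P₂ : ℝ, 0 < P₁ → 0 < P₂ → P₁ + P₂ ≤ 1 →
    (unifMeasure.prod unifMeasure) {q : ℝ × ℝ | V P₂ q.2 ≤ V P₁ q.1}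
      = ENNReal.ofReal (P₁ / (P₁ + P₂))

/-- Gluing requirement: `max{V(P₁,U₁), V(P₂,U₂)}` has the same distribution as
`V(P₁+P₂, U)`. -/
def GumbelCondII (V : ℝ → ℝ → EReal) : Prop :=
  ∀ P₁ P₂ : ℝ, 0 < P₁ → 0 < P₂ → P₁ + P₂ ≤ 1 →
    (unifMeasure.prod unifMeasure).map (fun q : ℝ × ℝ => max (V P₁ q.1) (V P₂ q.2))
      = unifMeasure.map (fun u : ℝ => V (P₁ + P₂) u)

instance : IsProbabilityMeasure unifMeasure :=
  ⟨by simp [unifMeasure]⟩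

lemma ae_unifMeasure : ∀ᵐ u ∂unifMeasure, u ∈ Set.Ioo (0 : ℝ) 1 :=
  ae_restrict_mem measurableSet_Ioo

lemma ae_unifMeasure_prod :
    ∀ᵐ q ∂(unifMeasure.prod unifMeasure),
      q.1 ∈ Set.Ioo (0 : ℝ) 1 ∧ q.2 ∈ Set.Ioo (0 : ℝ) 1 := by
  have h1 := (Measure.quasiMeasurePreserving_fst (μ := unifMeasure) (ν := unifMeasure)).ae
    ae_unifMeasure
  have h2 := (Measure.quasiMeasurePreserving_snd (μ := unifMeasure) (ν := unifMeasure)).ae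
    ae_unifMeasure
  filter_upwards [h1, h2] with q h1 h2 using ⟨h1, h2⟩

lemma unifMeasure_Iic {c : ℝ} (hc : c ≤ 1) : unifMeasure (Set.Iic c) = ENNReal.ofReal c := by
  have : unifMeasure = volume.restrict (Set.Ioc 0 1) := restrict_Ioo_eq_restrict_Ioc
  rw [this, Measure.restrict_apply measurableSet_Iic]
  have : Set.Iic c ∩ Set.Ioc 0 1 = Set.Ioc 0 c := by
    ext x
    simp only [Set.mem_inter_iff, Set.mem_Iic, Set.mem_Ioc]
    exact ⟨fun h => ⟨h.2.1, h.1⟩, fun h => ⟨h.2, h.1, h.2.trans hc⟩⟩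
  rw [this, Real.volume_Ioc, sub_zero]

lemma unifMeasure_exp_log_div_le {p c : ℝ} (hp : 0 < p) (hc0 : 0 ≤ c) (hc1 : c ≤ 1) :
    unifMeasure {u | Real.exp (Real.log u / p) ≤ c} = ENNReal.ofReal (c ^ p) := by
  rw [← unifMeasure_Iic (Real.rpow_le_one hc0 hc1 hp.le)]
  refine measure_congr ?_
  filter_upwards [ae_unifMeasure] with u hu
  refine propext ?_
  change Real.exp (Real.log u / p) ≤ c ↔ u ≤ c ^ p
  rw [div_eq_mul_inv, ← Real.rpow_def_of_pos hu.1, Real.rpow_inv_le_iff_of_pos hu.1.le hc0 hp]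

/-- A `[0,1]`-valued multiplicative function on `(0,1]` is a power function. -/
lemma eq_rpow_of_mul {f : ℝ → ℝ} (h0 : ∀ p, 0 ≤ f p) (h1 : ∀ p, f p ≤ 1)
    (hmul : ∀ p q, 0 < p → 0 < q → p + q ≤ 1 → f (p + q) = f p * f q)
    {p : ℝ} (hp0 : 0 < p) (hp1 : p ≤ 1) : f p = f 1 ^ p := by
  have hanti : ∀ a b, 0 < a → a < b → b ≤ 1 → f b ≤ f a := by
    intro a b ha hab hb
    have := hmul a (b - a) ha (by linarith) (by linarith)
    rw [add_sub_cancel] at this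
    rw [this]
    exact mul_le_of_le_one_right (h0 a) (h1 _)
  have hpow : ∀ (n : ℕ) (x : ℝ), 0 < x → (n + 1 : ℕ) * x ≤ 1 →
      f ((n + 1 : ℕ) * x) = f x ^ (n + 1) := by
    intro n x hx
    induction n with
    | zero => simp
    | succ n ih =>
      intro h
      push_cast at h ih ⊢
      rw [show ((n : ℝ) + 1 + 1) * x = (n + 1) * x + x by ring,
        hmul _ _ (by positivity) hx (by linarith), ih (by linarith), pow_succ _ (n + 1)]
  have hrat : ∀ q : ℚ, (0 : ℝ) < q → (q : ℝ) ≤ 1 → f q = f 1 ^ (q : ℝ) := by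
    intro q hq0 hq1
    have hq0' : 0 < q := by exact_mod_cast hq0
    have hd : (0 : ℝ) < q.den := by exact_mod_cast q.den_pos
    obtain ⟨d, hd'⟩ : ∃ d, q.den = d + 1 := Nat.exists_eq_succ_of_ne_zero q.den_nz
    obtain ⟨k, hk⟩ : ∃ k : ℕ, q.num = (k + 1 : ℕ) := by
      have := Rat.num_pos.2 hq0'
      exact ⟨(q.num - 1).toNat, by omega⟩
    have hq : (q : ℝ) = (k + 1 : ℕ) * (q.den : ℝ)⁻¹ := by
      rw [Rat.cast_def, hk, div_eq_mul_inv]; norm_cast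
    have hone : ((d + 1 : ℕ) : ℝ) * (q.den : ℝ)⁻¹ = 1 := by
      rw [← hd']; exact mul_inv_cancel₀ hd.ne'
    have e1 := hpow d _ (inv_pos.2 hd) hone.le
    have e2 := hpow k _ (inv_pos.2 hd) (hq ▸ hq1)
    rw [hone] at e1
    rw [← hq] at e2
    rw [e1, e2, ← Real.rpow_natCast, ← Real.rpow_natCast, ← Real.rpow_mul (h0 _)]
    congr 1
    rw [hq, mul_left_comm, hone, mul_one]
  have hcont : ContinuousAt (fun x : ℝ => f 1 ^ x) p := Real.continuousAt_const_rpow' hp0.ne'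
  refine le_antisymm (le_of_not_gt fun hlt => ?_) ?_
  · obtain ⟨ε, hε, hball⟩ := Metric.eventually_nhds_iff.1 (hcont.eventually_lt_const hlt)
    obtain ⟨q, hq1, hq2⟩ := exists_rat_btwn (show max 0 (p - ε) < p from max_lt hp0 (by linarith))
    have hq0 := (le_max_left _ _).trans_lt hq1
    have hqε := (le_max_right _ _).trans_lt hq1
    have := hball (y := q) (by rw [Real.dist_eq, abs_lt]; constructor <;> linarith)
    rw [← hrat q hq0 (by linarith)] at this
    exact (hanti _ _ hq0 hq2 hp1).not_gt this
  · rcases hp1.eq_or_lt with rfl | hp1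
    · simp
    refine le_of_not_gt fun hlt => ?_
    obtain ⟨ε, hε, hball⟩ := Metric.eventually_nhds_iff.1 (hcont.eventually_const_lt hlt)
    obtain ⟨q, hq1, hq2⟩ := exists_rat_btwn (show p < min 1 (p + ε) from lt_min hp1 (by linarith))
    have hq3 := hq2.trans_le (min_le_left _ _)
    have hqε := hq2.trans_le (min_le_right _ _)
    have := hball (y := q) (by rw [Real.dist_eq, abs_lt]; constructor <;> linarith)
    rw [← hrat q (by linarith) hq3.le] at this
    exact (hanti _ _ hp0 hq1 hq3.le).not_gt this

/-- The quantile function of a measure on the extended reals. -/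
noncomputable def erealQuantile (μ : Measure EReal) (t : ℝ) : EReal :=
  sInf {x | t ≤ μ.real (Set.Iic x)}

lemma erealQuantile_le_iff (μ : Measure EReal) [IsProbabilityMeasure μ] {t : ℝ} (ht : t ≤ 1)
    (x : EReal) : erealQuantile μ t ≤ x ↔ t ≤ μ.real (Set.Iic x) := by
  refine ⟨fun h => ?_, fun h => sInf_le h⟩
  have hne : {x | t ≤ μ.real (Set.Iic x)}.Nonempty := ⟨⊤, by simpa using ht⟩
  obtain ⟨v, hv, hlim, hmem⟩ := exists_seq_tendsto_sInf hne (OrderBot.bddBelow _)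
  have hinter : Set.Iic (erealQuantile μ t) = ⋂ n, Set.Iic (v n) := by
    ext y
    simp only [Set.mem_Iic, Set.mem_iInter]
    exact ⟨fun hy n => hy.trans (sInf_le (hmem n)), fun hy => ge_of_tendsto' hlim hy⟩
  have hlim' : Filter.Tendsto (fun n => μ.real (Set.Iic (v n))) Filter.atTop
      (nhds (μ.real (Set.Iic (erealQuantile μ t)))) := by
    rw [hinter]
    refine (ENNReal.tendsto_toReal (measure_ne_top _ _)).comp
      (tendsto_measure_iInter_atTop (fun n => measurableSet_Iic.nullMeasurableSet)
        (fun m n hmn => Set.Iic_subset_Iic.2 (hv hmn)) ⟨0, measure_ne_top _ _⟩)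
  exact (ge_of_tendsto' hlim' hmem).trans (measureReal_mono (Set.Iic_subset_Iic.2 h))

lemma monotone_erealQuantile (μ : Measure EReal) : Monotone (erealQuantile μ) :=
  fun _ _ hst => sInf_le_sInf fun _ hx => hst.trans hx

lemma map_erealQuantile (μ ν : Measure EReal) [IsProbabilityMeasure μ] [IsProbabilityMeasure ν]
    {p : ℝ} (hp : 0 < p) (h : ∀ x, ν.real (Set.Iic x) = μ.real (Set.Iic x) ^ p) :
    unifMeasure.map (fun u => erealQuantile μ (Real.exp (Real.log u / p))) = ν := by
  have hm : Measurable fun u : ℝ => erealQuantile μ (Real.exp (Real.log u / p)) :=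
    (monotone_erealQuantile μ).measurable.comp (by fun_prop)
  have := Measure.isProbabilityMeasure_map (μ := unifMeasure) hm.aemeasurable
  refine Measure.ext_of_Iic _ _ fun x => ?_
  rw [Measure.map_apply hm measurableSet_Iic, ← ofReal_measureReal (μ := ν), h,
    ← unifMeasure_exp_log_div_le hp measureReal_nonneg measureReal_le_one]
  refine measure_congr ?_
  filter_upwards [ae_unifMeasure] with u hu
  refine propext (erealQuantile_le_iff μ ?_ x)
  rw [Real.exp_le_one_iff]
  exact div_nonpos_of_nonpos_of_nonneg (Real.log_nonpos hu.1.le hu.2.le) hp.le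

lemma strictMonoOn_erealQuantile (μ : Measure EReal) [IsProbabilityMeasure μ] [NullSingletonClass μ] :
    StrictMonoOn (erealQuantile μ) (Set.Ioo 0 1) := by
  intro s hs t ht hst
  refine (monotone_erealQuantile μ hst.le).lt_of_ne fun heq => ?_
  have hmap := map_erealQuantile μ μ one_pos fun x => (Real.rpow_one _).symm
  have hm : Measurable fun u : ℝ => erealQuantile μ (Real.exp (Real.log u / 1)) :=
    (monotone_erealQuantile μ).measurable.comp (by fun_prop)
  have hzero : μ {erealQuantile μ s} = 0 := measure_singleton _
  rw [← hmap, Measure.map_apply hm (measurableSet_singleton _), hmap] at hzero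
  have hsub : Set.Ioo s t ⊆ (fun u : ℝ => erealQuantile μ (Real.exp (Real.log u / 1))) ⁻¹'
      {erealQuantile μ s} := by
    intro u hu
    have hu0 : 0 < u := hs.1.trans hu.1
    simp only [div_one, Real.exp_log hu0, Set.mem_preimage, Set.mem_singleton_iff]
    exact le_antisymm (heq ▸ monotone_erealQuantile μ hu.2.le) (monotone_erealQuantile μ hu.1.le)
  have hIoo := measure_mono_null hsub hzero
  rw [unifMeasure, Measure.restrict_apply measurableSet_Ioo,
    Set.inter_eq_left.2 (Set.Ioo_subset_Ioo hs.1.le ht.2.le), Real.volume_Ioo,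
    ENNReal.ofReal_eq_zero] at hIoo
  linarith

lemma map_max_Iic {X Y : ℝ → EReal} (hX : Measurable X) (hY : Measurable Y) (x : EReal) :
    (unifMeasure.prod unifMeasure).map (fun q : ℝ × ℝ => max (X q.1) (Y q.2)) (Set.Iic x)
      = unifMeasure.map X (Set.Iic x) * unifMeasure.map Y (Set.Iic x) := by
  rw [Measure.map_apply (by fun_prop) measurableSet_Iic, Measure.map_apply hX measurableSet_Iic,
    Measure.map_apply hY measurableSet_Iic, ← Measure.prod_prod]
  congr 1
  ext q
  simp

/-- If two independent copies of `X` are ordered either way with probability `1/2`, then the law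
of `X` has no atoms. -/
lemma measure_fiber_eq_zero {X : ℝ → EReal} (hX : Measurable X)
    (h : (unifMeasure.prod unifMeasure) {q : ℝ × ℝ | X q.2 ≤ X q.1} = ENNReal.ofReal (1 / 2))
    (x : EReal) : unifMeasure (X ⁻¹' {x}) = 0 := by
  set A := {q : ℝ × ℝ | X q.2 ≤ X q.1} with hA
  set B := {q : ℝ × ℝ | X q.1 ≤ X q.2} with hB
  have hAm : MeasurableSet A := measurableSet_le (by fun_prop) (by fun_prop)
  have hBm : MeasurableSet B := measurableSet_le (by fun_prop) (by fun_prop)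
  have hB2 : (unifMeasure.prod unifMeasure) B = ENNReal.ofReal (1 / 2) := by
    rw [← h, ← Measure.prod_swap, Measure.map_apply measurable_swap hBm]
    simp only [Measure.prod_swap]
    rfl
  have hU : A ∪ B = Set.univ := by
    ext q
    simpa [hA, hB] using le_total (X q.2) (X q.1)
  have hsum := measure_union_add_inter (μ := unifMeasure.prod unifMeasure) A hBm
  rw [hU, measure_univ, h, hB2, ← ENNReal.ofReal_add (by norm_num) (by norm_num)] at hsum
  norm_num at hsum
  have hsub : (X ⁻¹' {x}) ×ˢ (X ⁻¹' {x}) ⊆ A ∩ B := by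
    rintro ⟨a, b⟩ ⟨ha, hb⟩
    simp only [Set.mem_preimage, Set.mem_singleton_iff] at ha hb
    simp [hA, hB, ha, hb]
  have := measure_mono_null hsub hsum
  rw [Measure.prod_prod] at this
  simpa using this

lemma nullSingletonClass_map_one {V : ℝ → ℝ → EReal} (hmeas : ∀ p : ℝ, Measurable (V p))
    (hI : GumbelCondI V) (hII : GumbelCondII V) : NullSingletonClass (unifMeasure.map (V 1)) := by
  refine ⟨fun x => ?_⟩
  have hhalf := measure_fiber_eq_zero (hmeas (1 / 2)) (x := x) (by
    have := hI (1 / 2) (1 / 2) (by norm_num) (by norm_num) (by norm_num)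
    norm_num at this ⊢
    exact this)
  have hglue := hII (1 / 2) (1 / 2) (by norm_num) (by norm_num) (by norm_num)
  rw [add_halves] at hglue
  have hm := hmeas (1 / 2)
  rw [← hglue, Measure.map_apply (by fun_prop) (measurableSet_singleton x)]
  refine measure_mono_null (t := ((V (1 / 2) ⁻¹' {x}) ×ˢ Set.univ) ∪
    (Set.univ ×ˢ (V (1 / 2) ⁻¹' {x}))) ?_ ?_
  · rintro ⟨a, b⟩ hab
    simp only [Set.mem_preimage, Set.mem_singleton_iff] at hab
    rcases max_choice (V (1 / 2) a) (V (1 / 2) b) with h | h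
    · exact Or.inl ⟨h.symm.trans hab, trivial⟩
    · exact Or.inr ⟨trivial, h.symm.trans hab⟩
  · rw [measure_union_null_iff, Measure.prod_prod, Measure.prod_prod, hhalf]
    simp

lemma exists_strictMonoOn_of_gumbelCond {V : ℝ → ℝ → EReal} (hmeas : ∀ p : ℝ, Measurable (V p))
    (hI : GumbelCondI V) (hII : GumbelCondII V) :
    ∃ g : ℝ → EReal, StrictMonoOn g (Set.Iio (0:ℝ)) ∧
      ∀ p : ℝ, 0 < p → p ≤ 1 →
        unifMeasure.map (fun u : ℝ => V p u)
          = unifMeasure.map (fun u : ℝ => g (Real.log u / p)) := by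
  have := nullSingletonClass_map_one hmeas hI hII
  have hprob : ∀ p, IsProbabilityMeasure (unifMeasure.map (V p)) := fun p =>
    Measure.isProbabilityMeasure_map (hmeas p).aemeasurable
  refine ⟨fun z => erealQuantile (unifMeasure.map (V 1)) (Real.exp z), ?_, fun p hp0 hp1 => ?_⟩
  · exact (strictMonoOn_erealQuantile _).comp (Real.exp_strictMono.strictMonoOn _)
      fun z hz => ⟨Real.exp_pos z, Real.exp_lt_one_iff.2 hz⟩
  · refine (map_erealQuantile _ _ hp0 fun x => ?_).symm
    refine eq_rpow_of_mul (f := fun p => (unifMeasure.map (V p)).real (Set.Iic x))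
      (fun _ => measureReal_nonneg) (fun _ => measureReal_le_one) (fun a b ha hb hab => ?_) hp0 hp1
    simp only [Measure.real]
    rw [← ENNReal.toReal_mul, ← map_max_Iic (hmeas a) (hmeas b), hII a b ha hb hab]

lemma unifMeasure_log_div_le {p : ℝ} (hp : 0 < p) (x : ℝ) :
    unifMeasure {u | Real.log u / p ≤ x} = ENNReal.ofReal (Real.exp (min 0 x) ^ p) := by
  rw [← unifMeasure_exp_log_div_le hp (Real.exp_pos _).le (Real.exp_le_one_iff.2 (min_le_left _ _))]
  refine measure_congr ?_
  filter_upwards [ae_unifMeasure] with u hu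
  refine propext ?_
  have : Real.log u / p ≤ 0 :=
    div_nonpos_of_nonpos_of_nonneg (Real.log_nonpos hu.1.le hu.2.le) hp.le
  change Real.log u / p ≤ x ↔ Real.exp (Real.log u / p) ≤ Real.exp (min 0 x)
  rw [Real.exp_le_exp, le_min_iff, and_iff_right this]

lemma map_max_log_div {p q : ℝ} (hp : 0 < p) (hq : 0 < q) :
    (unifMeasure.prod unifMeasure).map
        (fun w : ℝ × ℝ => max (Real.log w.1 / p) (Real.log w.2 / q))
      = unifMeasure.map (fun u => Real.log u / (p + q)) := by
  have hm : Measurable fun w : ℝ × ℝ => max (Real.log w.1 / p) (Real.log w.2 / q) := by fun_prop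
  have := Measure.isProbabilityMeasure_map (μ := unifMeasure.prod unifMeasure) hm.aemeasurable
  refine Measure.ext_of_Iic _ _ fun x => ?_
  rw [Measure.map_apply hm measurableSet_Iic, Measure.map_apply (by fun_prop) measurableSet_Iic]
  have hset : (fun w : ℝ × ℝ => max (Real.log w.1 / p) (Real.log w.2 / q)) ⁻¹' Set.Iic x
      = {u | Real.log u / p ≤ x} ×ˢ {u | Real.log u / q ≤ x} := by
    ext w
    simp
  rw [hset, Measure.prod_prod, unifMeasure_log_div_le hp, unifMeasure_log_div_le hq,
    ← ENNReal.ofReal_mul (by positivity), ← Real.rpow_add (Real.exp_pos _)]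
  exact (unifMeasure_log_div_le (add_pos hp hq) x).symm

lemma prod_log_div_le {p q : ℝ} (hp : 0 < p) (hq : 0 < q) :
    (unifMeasure.prod unifMeasure) {w : ℝ × ℝ | Real.log w.2 / q ≤ Real.log w.1 / p}
      = ENNReal.ofReal (p / (p + q)) := by
  rw [Measure.prod_apply (measurableSet_le (by fun_prop) (by fun_prop))]
  have hae : (fun u => unifMeasure (Prod.mk u ⁻¹'
      {w : ℝ × ℝ | Real.log w.2 / q ≤ Real.log w.1 / p}))
      =ᵐ[unifMeasure] fun u => ENNReal.ofReal (u ^ (q / p)) := by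
    filter_upwards [ae_unifMeasure] with u hu
    have hle : Real.log u / p ≤ 0 :=
      div_nonpos_of_nonpos_of_nonneg (Real.log_nonpos hu.1.le hu.2.le) hp.le
    refine (unifMeasure_log_div_le hq (Real.log u / p)).trans ?_
    rw [min_eq_right hle, ← Real.exp_mul, Real.rpow_def_of_pos hu.1]
    congr 2
    ring
  have hr : 0 < q / p := div_pos hq hp
  have hint : IntegrableOn (fun u : ℝ => u ^ (q / p)) (Set.Ioc 0 1) :=
    (intervalIntegrable_iff_integrableOn_Ioc_of_le zero_le_one).1
      (intervalIntegral.intervalIntegrable_rpow' (by linarith))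
  rw [lintegral_congr_ae hae, unifMeasure, restrict_Ioo_eq_restrict_Ioc,
    ← ofReal_integral_eq_lintegral_ofReal hint, ← intervalIntegral.integral_of_le zero_le_one,
    integral_rpow (Or.inl (by linarith)), Real.one_rpow, Real.zero_rpow (by linarith)]
  · congr 1
    field_simp
    ring
  · filter_upwards [ae_restrict_mem measurableSet_Ioc] with u hu using Real.rpow_nonneg hu.1.le _

section Converse

variable {V : ℝ → ℝ → EReal} {g : ℝ → EReal}

lemma gumbelCondI_of_eq (hg : StrictMonoOn g (Set.Iio (0:ℝ)))
    (hV : ∀ p u : ℝ, 0 < p → p ≤ 1 → 0 < u → u < 1 → V p u = g (Real.log u / p)) :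
    GumbelCondI V := by
  intro p q hp hq hpq
  rw [← prod_log_div_le hp hq]
  refine measure_congr ?_
  filter_upwards [ae_unifMeasure_prod] with w hw
  obtain ⟨h1, h2⟩ := hw
  refine propext ?_
  change V q w.2 ≤ V p w.1 ↔ Real.log w.2 / q ≤ Real.log w.1 / p
  rw [hV q _ hq (by linarith) h2.1 h2.2, hV p _ hp (by linarith) h1.1 h1.2]
  exact hg.le_iff_le (div_neg_of_neg_of_pos (Real.log_neg h2.1 h2.2) hq)
    (div_neg_of_neg_of_pos (Real.log_neg h1.1 h1.2) hp)

lemma gumbelCondII_of_eq (hg : StrictMonoOn g (Set.Iio (0:ℝ)))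
    (hV : ∀ p u : ℝ, 0 < p → p ≤ 1 → 0 < u → u < 1 → V p u = g (Real.log u / p)) :
    GumbelCondII V := by
  intro p q hp hq hpq
  let G : ℝ → EReal := fun z => if z < 0 then g z else ⊤
  have hG : Monotone G := by
    intro a b hab
    by_cases hb : b < 0
    · simpa [G, hb, hab.trans_lt hb] using hg.monotoneOn (hab.trans_lt hb) hb hab
    · simp [G, hb]
  have hVG : ∀ r u : ℝ, 0 < r → r ≤ 1 → u ∈ Set.Ioo (0:ℝ) 1 → V r u = G (Real.log u / r) := by
    intro r u hr0 hr1 hu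
    rw [hV r u hr0 hr1 hu.1 hu.2]
    exact (if_pos (div_neg_of_neg_of_pos (Real.log_neg hu.1 hu.2) hr0)).symm
  have hl : (fun w : ℝ × ℝ => max (V p w.1) (V q w.2)) =ᵐ[unifMeasure.prod unifMeasure]
      G ∘ fun w => max (Real.log w.1 / p) (Real.log w.2 / q) := by
    filter_upwards [ae_unifMeasure_prod] with w hw
    rw [hVG p _ hp (by linarith) hw.1, hVG q _ hq (by linarith) hw.2, ← hG.map_max]
    rfl
  have hr : (fun u : ℝ => V (p + q) u) =ᵐ[unifMeasure]
      G ∘ fun u => Real.log u / (p + q) := by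
    filter_upwards [ae_unifMeasure] with u hu using hVG _ _ (by linarith) hpq hu
  rw [Measure.map_congr hl, Measure.map_congr hr, ← Measure.map_map hG.measurable (by fun_prop),
    ← Measure.map_map hG.measurable (by fun_prop), map_max_log_div hp hq]

end Converse

/-- Uniqueness of the Gumbel-max decoder: a decoder `V` satisfies the two
unbiasedness requirements iff it is (in distribution) a strictly increasing
transform of `(log u)/p`. -/
theorem gumbel_decoder_unique (V : ℝ → ℝ → EReal) (hmeas : ∀ p : ℝ, Measurable (V p)) :
    ((GumbelCondI V ∧ GumbelCondII V) →
      ∃ g : ℝ → EReal, StrictMonoOn g (Set.Iio (0:ℝ)) ∧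
        ∀ p : ℝ, 0 < p → p ≤ 1 →
          unifMeasure.map (fun u : ℝ => V p u)
            = unifMeasure.map (fun u : ℝ => g (Real.log u / p)))
    ∧ ((∃ g : ℝ → EReal, StrictMonoOn g (Set.Iio (0:ℝ)) ∧
          ∀ p u : ℝ, 0 < p → p ≤ 1 → 0 < u → u < 1 → V p u = g (Real.log u / p)) →
        (GumbelCondI V ∧ GumbelCondII V)) := by
  exact ⟨fun h => exists_strictMonoOn_of_gumbelCond hmeas h.1 h.2,
    fun ⟨_, hg, hV⟩ => ⟨gumbelCondI_of_eq hg hV, gumbelCondII_of_eq hg hV⟩⟩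
end

section
/- Let W be a finite nonempty set and P : W → (0,1] a probability vector with Σ_{w∈W} P_w = 1. Let (U_w)_{w∈W} be independent Uniform(0,1) random variables, and let w* denote the almost-surely unique element of W maximizing (log U_w)/P_w over w ∈ W. Then for every r ∈ [0,1], P( U_{w*} ≤ r ) = Σ_{w∈W} P_w · r^{1/P_w}. -/
open MeasureTheory
open scoped ENNReal

/-- The law of `|W|` i.i.d. `Uniform(0,1)` random variables indexed by `W`. -/
noncomputable def iidUnif (W : Type*) [Fintype W] : Measure (W → ℝ) :=
  Measure.pi fun _ : W => volume.restrict (Set.Ioo 0 1)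

instance {W : Type*} [Fintype W] : IsProbabilityMeasure (iidUnif W) := by
  have : IsProbabilityMeasure (volume.restrict (Set.Ioo (0 : ℝ) 1)) := ⟨by simp⟩
  unfold iidUnif
  infer_instance

/-- Almost surely, every coordinate lies in the open unit interval. -/
lemma iidUnif_ae_mem_Ioo (W : Type*) [Fintype W] :
    ∀ᵐ u ∂(iidUnif W), ∀ w, u w ∈ Set.Ioo (0 : ℝ) 1 := by
  rw [ae_all_iff]
  intro w
  have h : ∀ᵐ x ∂(volume.restrict (Set.Ioo (0 : ℝ) 1)), x ∈ Set.Ioo (0 : ℝ) 1 :=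
    ae_restrict_mem measurableSet_Ioo
  exact (Measure.tendsto_eval_ae_ae (μ := fun _ : W => volume.restrict (Set.Ioo (0 : ℝ) 1))
    (i := w)).eventually h

lemma log_div_le_log_div_iff {x y p q : ℝ} (hx : 0 < x) (hy : 0 < y) (hp : 0 < p) :
    Real.log x / p ≤ Real.log y / q ↔ x ≤ y ^ (p / q) := by
  rw [Real.le_rpow_iff_log_le hx hy, div_le_iff₀ hp]
  ring_nf

/-- Disintegration along one coordinate: the other coordinates are independent of it. -/
lemma iidUnif_coord_le_fun {W : Type*} [Fintype W] [DecidableEq W] (w : W) {I : Set ℝ}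
    (hI : MeasurableSet I) (g : W → ℝ → ℝ) (hg : ∀ v, Measurable (g v)) :
    iidUnif W {u | u w ∈ I ∧ ∀ v, v ≠ w → u v ≤ g v (u w)} =
      ∫⁻ x in I, ∏ v : {v // v ≠ w}, volume (Set.Iic (g v x) ∩ Set.Ioo 0 1)
        ∂(volume.restrict (Set.Ioo 0 1)) := by
  set ν : Measure ℝ := volume.restrict (Set.Ioo 0 1) with hν
  have hS : MeasurableSet {u : W → ℝ | u w ∈ I ∧ ∀ v, v ≠ w → u v ≤ g v (u w)} := by
    have h : MeasurableSet {u : W → ℝ | ∀ v, v ≠ w → u v ≤ g v (u w)} := by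
      simp only [Set.ofPred_forall]
      exact MeasurableSet.iInter fun v => MeasurableSet.iInter fun _ =>
        measurableSet_le (measurable_pi_apply v) ((hg v).comp (measurable_pi_apply w))
    exact (measurable_pi_apply w hI).inter h
  have hmp := (measurePreserving_piEquivPiSubtypeProd (fun _ : W => ν) (fun v => v = w)).symm
  have hu : MeasurePreserving (MeasurableEquiv.piUnique fun _ : {v // v = w} => ℝ)
      (@Measure.pi _ _ (Subtype.fintype _) _ fun _ => ν) ν := by
    convert measurePreserving_piUnique (fun _ : {v // v = w} => ν)
  rw [iidUnif, ← hmp.measure_preimage hS.nullMeasurableSet,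
    Measure.prod_apply (hmp.measurable hS), ← lintegral_indicator hI,
    ← hu.lintegral_comp_emb (MeasurableEquiv.measurableEmbedding _)]
  refine lintegral_congr fun x => ?_
  have hx : MeasurableEquiv.piUnique (fun _ : {v // v = w} => ℝ) x = x ⟨w, rfl⟩ := rfl
  rw [hx]
  by_cases hxI : x ⟨w, rfl⟩ ∈ I
  · rw [Set.indicator_of_mem hxI]
    have : Prod.mk x ⁻¹' ((MeasurableEquiv.piEquivPiSubtypeProd (fun _ : W => ℝ)
        (fun v => v = w)).symm ⁻¹' {u | u w ∈ I ∧ ∀ v, v ≠ w → u v ≤ g v (u w)}) =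
        Set.univ.pi fun v : {v // v ≠ w} => Set.Iic (g v (x ⟨w, rfl⟩)) := by
      ext y
      simp +contextual [MeasurableEquiv.piEquivPiSubtypeProd, Equiv.piEquivPiSubtypeProd, hxI,
        Pi.le_def]
    rw [this, Measure.pi_pi]
    refine Finset.prod_congr rfl fun v _ => ?_
    rw [hν, Measure.restrict_apply measurableSet_Iic]
  · rw [Set.indicator_of_notMem hxI]
    refine measure_mono_null (t := ∅) (fun y hy => ?_) measure_empty
    revert hy
    simp [MeasurableEquiv.piEquivPiSubtypeProd, Equiv.piEquivPiSubtypeProd, hxI]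

lemma iidUnif_argmax_mem_Ioc_le {W : Type*} [Fintype W] (P : W → ℝ) (hpos : ∀ w, 0 < P w)
    (hsum : ∑ w, P w = 1) (w : W) {a b : ℝ} (ha : 0 ≤ a) (hab : a ≤ b) :
    iidUnif W {u | u w ∈ Set.Ioc a b ∧ ∀ v, Real.log (u v) / P v ≤ Real.log (u w) / P w} ≤
      ENNReal.ofReal (P w * (b ^ (1 / P w) - a ^ (1 / P w))) := by
  classical
  have hw := hpos w
  have hw1 : P w ≤ 1 := hsum ▸ Finset.single_le_sum (fun v _ => (hpos v).le) (Finset.mem_univ w)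
  have hexp : 0 ≤ 1 / P w - 1 := by
    rw [sub_nonneg, le_div_iff₀ hw]; linarith
  have hrest : ∑ v : {v // v ≠ w}, P v / P w = 1 / P w - 1 := by
    have h := Fintype.sum_eq_add_sum_subtype_ne P w
    rw [hsum] at h
    rw [← Finset.sum_div, div_sub_one hw.ne', eq_sub_of_add_eq' h.symm]
  calc iidUnif W {u | u w ∈ Set.Ioc a b ∧ ∀ v, Real.log (u v) / P v ≤ Real.log (u w) / P w}
      ≤ iidUnif W {u | u w ∈ Set.Ioc a b ∧ ∀ v, v ≠ w → u v ≤ u w ^ (P v / P w)} := by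
        refine measure_mono_ae ?_
        filter_upwards [iidUnif_ae_mem_Ioo W] with u hu h
        exact ⟨h.1, fun v _ => (log_div_le_log_div_iff (hu v).1 (hu w).1 (hpos v)).1 (h.2 v)⟩
    _ = ∫⁻ x in Set.Ioc a b, ∏ v : {v // v ≠ w},
          volume (Set.Iic (x ^ (P v / P w)) ∩ Set.Ioo 0 1)
          ∂(volume.restrict (Set.Ioo 0 1)) :=
        iidUnif_coord_le_fun w measurableSet_Ioc (fun v x => x ^ (P v / P w))
          fun v => by fun_prop
    _ ≤ ∫⁻ x in Set.Ioc a b, ∏ v : {v // v ≠ w},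
          volume (Set.Iic (x ^ (P v / P w)) ∩ Set.Ioo 0 1) :=
        lintegral_mono' (Measure.restrict_mono le_rfl Measure.restrict_le_self) le_rfl
    _ ≤ ∫⁻ x in Set.Ioc a b, ENNReal.ofReal (x ^ (1 / P w - 1)) := by
        refine setLIntegral_mono' measurableSet_Ioc fun x hx => ?_
        have hx0 : 0 < x := ha.trans_lt hx.1
        rw [← hrest, Real.rpow_sum_of_pos hx0,
          ENNReal.ofReal_prod_of_nonneg fun v _ => Real.rpow_nonneg hx0.le _]
        refine Finset.prod_le_prod' fun v _ => ?_
        refine (measure_mono (t := Set.Ioc 0 (x ^ (P v / P w)))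
          fun y hy => ⟨hy.2.1, hy.1⟩).trans ?_
        simp
    _ = ENNReal.ofReal (∫ x in a..b, x ^ (1 / P w - 1)) := by
        rw [intervalIntegral.integral_of_le hab, ofReal_integral_eq_lintegral_ofReal]
        · exact (intervalIntegrable_iff_integrableOn_Ioc_of_le hab).1
            (intervalIntegral.intervalIntegrable_rpow' (by linarith))
        · filter_upwards [ae_restrict_mem measurableSet_Ioc] with x hx
          exact Real.rpow_nonneg (ha.trans hx.1.le) _
    _ = ENNReal.ofReal (P w * (b ^ (1 / P w) - a ^ (1 / P w))) := by
        rw [integral_rpow (Or.inl (by linarith)), sub_add_cancel, div_div_eq_mul_div, div_one,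
          mul_comm]

/-- CDF of the Gumbel-max pivotal statistic: if `w*` is the (a.s. unique) maximizer
of `(log U_w)/P_w`, then `P(U_{w*} ≤ r) = Σ_w P_w r^{1/P_w}`. -/
theorem gumbel_pivot_cdf {W : Type*} [Fintype W] [Nonempty W]
    (P : W → ℝ) (hpos : ∀ w, 0 < P w) (hsum : ∑ w, P w = 1)
    (sel : (W → ℝ) → W)
    (hsel : ∀ᵐ u ∂(iidUnif W), ∀ w : W,
      Real.log (u w) / P w ≤ Real.log (u (sel u)) / P (sel u))
    (r : ℝ) (hr : r ∈ Set.Icc (0:ℝ) 1) :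
    iidUnif W {u | u (sel u) ≤ r} = ENNReal.ofReal (∑ w, P w * r ^ (1 / P w)) := by
  have key : ∀ a b : ℝ, 0 ≤ a → a ≤ b → iidUnif W {u | u (sel u) ∈ Set.Ioc a b} ≤
      ENNReal.ofReal (∑ w, P w * (b ^ (1 / P w) - a ^ (1 / P w))) := by
    intro a b ha hab
    rw [ENNReal.ofReal_sum_of_nonneg fun w _ => mul_nonneg (hpos w).le (sub_nonneg.2
      (Real.rpow_le_rpow ha hab (one_div_pos.2 (hpos w)).le))]
    refine le_trans ?_ ((measure_iUnion_fintype_le _ _).trans (Finset.sum_le_sum fun w _ =>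
      iidUnif_argmax_mem_Ioc_le P hpos hsum w ha hab))
    refine measure_mono_ae ?_
    filter_upwards [hsel] with u hu h
    exact Set.mem_iUnion.2 ⟨sel u, h, hu⟩
  have hnonneg : 0 ≤ ∑ w, P w * r ^ (1 / P w) :=
    Finset.sum_nonneg fun w _ => mul_nonneg (hpos w).le (Real.rpow_nonneg hr.1 _)
  apply le_antisymm
  · refine (measure_mono_ae ?_).trans ((key 0 r le_rfl hr.1).trans_eq ?_)
    · filter_upwards [iidUnif_ae_mem_Ioo W] with u hu h
      exact ⟨(hu _).1, h⟩
    · congr 1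
      refine Finset.sum_congr rfl fun w _ => ?_
      rw [Real.zero_rpow (one_div_pos.2 (hpos w)).ne', sub_zero]
  · have hcompl : iidUnif W {u | u (sel u) ≤ r}ᶜ ≤
        ENNReal.ofReal (1 - ∑ w, P w * r ^ (1 / P w)) := by
      refine (measure_mono_ae ?_).trans ((key r 1 hr.1 hr.2).trans_eq ?_)
      · filter_upwards [iidUnif_ae_mem_Ioo W] with u hu h
        exact ⟨not_le.1 h, (hu _).2.le⟩
      · simp [mul_sub, Finset.sum_sub_distrib, hsum]
    have hle : ∑ w, P w * r ^ (1 / P w) ≤ 1 := by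
      refine (Finset.sum_le_sum fun w _ => mul_le_of_le_one_right (hpos w).le
        (Real.rpow_le_one hr.1 hr.2 (one_div_pos.2 (hpos w)).le)).trans_eq hsum
    have htotal : 1 ≤ iidUnif W {u | u (sel u) ≤ r} +
        ENNReal.ofReal (1 - ∑ w, P w * r ^ (1 / P w)) := by
      rw [← measure_univ (μ := iidUnif W), ← Set.union_compl_self {u | u (sel u) ≤ r}]
      exact (measure_union_le _ _).trans (add_le_add_right hcompl _)
    refine ENNReal.le_of_add_le_add_right
      (ENNReal.ofReal_ne_top (r := 1 - ∑ w, P w * r ^ (1 / P w))) ?_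
    rw [← ENNReal.ofReal_add hnonneg (sub_nonneg.2 hle)]
    simpa using htotal
end

section
/- Let W be a finite nonempty vocabulary. For every nondecreasing function h : [0,1] → ℝ, the map P ↦ φ_h(P) = ∫_{[0,1]} e^{−h(r)} μ_{1,P}(dr), taking values in (0, ∞], is convex on the simplex Simp(W): for all probability vectors P, Q on W and t ∈ [0,1], φ_h(tP + (1−t)Q) ≤ t·φ_h(P) + (1−t)·φ_h(Q). -/
open MeasureTheory
open scoped ENNReal

/-- For `r ∈ [0, 1]`, the function `p ↦ p * r ^ (1 / p)` (the perspective of `x ↦ r ^ x`) is convex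
on `[0, ∞)`. -/
theorem convexOn_mul_rpow_one_div {r : ℝ} (hr0 : 0 ≤ r) (hr1 : r ≤ 1) :
    ConvexOn ℝ (Set.Ici 0) fun p : ℝ ↦ p * r ^ (1 / p) := by
  rcases hr0.eq_or_lt with rfl | hr
  · have hzero (p : ℝ) : p * (0 : ℝ) ^ (1 / p) = 0 := by
      rcases eq_or_ne p 0 with rfl | hp
      · simp
      · rw [Real.zero_rpow (one_div_ne_zero hp), mul_zero]
    simpa only [hzero] using convexOn_const (0 : ℝ) (convex_Ici (0 : ℝ))
  have hscale {a q : ℝ} (ha0 : 0 < a) (ha1 : a ≤ 1) (hq : 0 < q) :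
      a * q * r ^ (1 / (a * q)) ≤ a * (q * r ^ (1 / q)) := by
    rw [mul_assoc]
    gcongr a * (q * ?_)
    refine Real.rpow_le_rpow_of_exponent_ge hr hr1 (one_div_le_one_div_of_le (by positivity) ?_)
    exact mul_le_of_le_one_left hq.le ha1
  refine convexOn_iff_forall_pos.2 ⟨convex_Ici 0, fun p hp q hq a b ha hb hab ↦ ?_⟩
  simp only [smul_eq_mul]
  rcases (Set.mem_Ici.1 hp).eq_or_lt with rfl | hp
  · rcases (Set.mem_Ici.1 hq).eq_or_lt with rfl | hq
    · simp
    · simpa using hscale hb (by linarith) hq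
  rcases (Set.mem_Ici.1 hq).eq_or_lt with rfl | hq
  · simpa using hscale ha (by linarith) hp
  have hs : 0 < a * p + b * q := by positivity
  have key := (convexOn_rpow_left hr).2 (Set.mem_univ (1 / p)) (Set.mem_univ (1 / q))
    (by positivity : 0 ≤ a * p / (a * p + b * q)) (by positivity : 0 ≤ b * q / (a * p + b * q))
    (by field_simp)
  have hmean : a * p / (a * p + b * q) * (1 / p) + b * q / (a * p + b * q) * (1 / q)
      = 1 / (a * p + b * q) := by
    field_simp
    exact hab
  simp only [smul_eq_mul, hmean] at key
  calc (a * p + b * q) * r ^ (1 / (a * p + b * q))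
      ≤ (a * p + b * q) * (a * p / (a * p + b * q) * r ^ (1 / p)
          + b * q / (a * p + b * q) * r ^ (1 / q)) := by gcongr
    _ = a * (p * r ^ (1 / p)) + b * (q * r ^ (1 / q)) := by field_simp

/-- A finite measure on `ℝ` whose distribution function is pointwise at most that of another measure
gives at most the same mass to every measurable lower set. -/
theorem measure_le_of_isLowerSet {μ ν : Measure ℝ} [IsFiniteMeasure μ]
    (hle : ∀ r, μ (Set.Iic r) ≤ ν (Set.Iic r)) {s : Set ℝ} (hs : IsLowerSet s)
    (hsm : MeasurableSet s) : μ s ≤ ν s := by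
  refine le_of_forall_lt fun c hc ↦ ?_
  obtain ⟨K, hKs, hK, hcK⟩ := hsm.exists_lt_isCompact_of_ne_top (measure_ne_top μ s) hc
  have hne : K.Nonempty := by
    rw [Set.nonempty_iff_ne_empty]
    rintro rfl
    simp at hcK
  calc c < μ K := hcK
    _ ≤ μ (Set.Iic (sSup K)) := measure_mono fun x hx ↦ le_csSup hK.bddAbove hx
    _ ≤ ν (Set.Iic (sSup K)) := hle _
    _ ≤ ν s := measure_mono (hs.Iic_subset (hKs (hK.sSup_mem hne)))

/-- First-order stochastic dominance: integrals of nonnegative antitone functions are monotone in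
the distribution function. -/
theorem Antitone.lintegral_ofReal_le {μ ν : Measure ℝ} [IsFiniteMeasure μ]
    (hle : ∀ r, μ (Set.Iic r) ≤ ν (Set.Iic r)) {f : ℝ → ℝ} (hf : Antitone f) (hf0 : 0 ≤ f) :
    ∫⁻ r, ENNReal.ofReal (f r) ∂μ ≤ ∫⁻ r, ENNReal.ofReal (f r) ∂ν := by
  rw [lintegral_eq_lintegral_meas_le μ (ae_of_all _ hf0) hf.measurable.aemeasurable,
    lintegral_eq_lintegral_meas_le ν (ae_of_all _ hf0) hf.measurable.aemeasurable]
  exact lintegral_mono fun t ↦ measure_le_of_isLowerSet hle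
    (fun x y hyx (hx : t ≤ f x) ↦ hx.trans (hf hyx))
    (measurableSet_le measurable_const hf.measurable)

/-- Convexity Lemma for the Gumbel-max watermark: for every nondecreasing score
function `h` on `[0,1]`, the map `P ↦ φ_h(P) = ∫ e^{-h} dμ_{1,P}` is convex on the
simplex, where `μ1 P` is the probability measure on `[0,1]` whose CDF is
`r ↦ Σ_w P_w r^{1/P_w}`. -/
theorem gumbel_mgf_convex {W : Type*} [Fintype W] [Nonempty W]
    (μ1 : (W → ℝ) → Measure ℝ)
    (hμprob : ∀ P : W → ℝ, (∀ w, 0 ≤ P w) → ∑ w, P w = 1 → IsProbabilityMeasure (μ1 P))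
    (hμcdf : ∀ P : W → ℝ, (∀ w, 0 ≤ P w) → ∑ w, P w = 1 → ∀ r ∈ Set.Icc (0:ℝ) 1,
      μ1 P (Set.Iic r) = ENNReal.ofReal (∑ w, P w * r ^ (1 / P w)))
    (h : ℝ → ℝ) (hmono : MonotoneOn h (Set.Icc 0 1)) :
    ∀ P Q : W → ℝ, (∀ w, 0 ≤ P w) → ∑ w, P w = 1 → (∀ w, 0 ≤ Q w) → ∑ w, Q w = 1 →
      ∀ t ∈ Set.Icc (0:ℝ) 1,
        (∫⁻ r, ENNReal.ofReal (Real.exp (-h r)) ∂(μ1 (t • P + (1 - t) • Q)))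
          ≤ ENNReal.ofReal t * (∫⁻ r, ENNReal.ofReal (Real.exp (-h r)) ∂(μ1 P))
            + ENNReal.ofReal (1 - t) * (∫⁻ r, ENNReal.ofReal (Real.exp (-h r)) ∂(μ1 Q)) := by
  intro P Q hP hP1 hQ hQ1 t ⟨ht0, ht1⟩
  have hR : ∀ w, 0 ≤ (t • P + (1 - t) • Q) w := fun w ↦
    add_nonneg (mul_nonneg ht0 (hP w)) (mul_nonneg (sub_nonneg.2 ht1) (hQ w))
  have hR1 : ∑ w, (t • P + (1 - t) • Q) w = 1 := by
    simp [Finset.sum_add_distrib, ← Finset.mul_sum, hP1, hQ1]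
  have hzero {S : W → ℝ} (hS : ∀ w, 0 ≤ S w) (hS1 : ∑ w, S w = 1) : μ1 S (Set.Iic 0) = 0 := by
    rw [hμcdf S hS hS1 0 (by simp), ENNReal.ofReal_eq_zero]
    refine (Finset.sum_eq_zero fun w _ ↦ ?_).le
    rcases eq_or_ne (S w) 0 with hw | hw
    · simp [hw]
    · rw [Real.zero_rpow (one_div_ne_zero hw), mul_zero]
  have hone {S : W → ℝ} (hS : ∀ w, 0 ≤ S w) (hS1 : ∑ w, S w = 1) : μ1 S (Set.Iic 1) = 1 := by
    rw [hμcdf S hS hS1 1 (by simp)]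
    simp [hS1]
  have hae {S : W → ℝ} (hS : ∀ w, 0 ≤ S w) (hS1 : ∑ w, S w = 1) :
      ∀ᵐ r ∂μ1 S, r ∈ Set.Icc (0 : ℝ) 1 := by
    have := hμprob S hS hS1
    have h0 : ∀ᵐ r ∂μ1 S, r ∉ Set.Iic (0 : ℝ) := measure_eq_zero_iff_ae_notMem.1 (hzero hS hS1)
    have h1 : ∀ᵐ r ∂μ1 S, r ∈ Set.Iic (1 : ℝ) :=
      (mem_ae_iff_prob_eq_one measurableSet_Iic).2 (hone hS hS1)
    filter_upwards [h0, h1] with r hr0 hr1 using ⟨(not_le.1 hr0).le, hr1⟩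
  let f : ℝ → ℝ := fun r ↦ Real.exp (-h (Set.projIcc 0 1 zero_le_one r))
  have hf : Antitone f := fun x y hxy ↦ Real.exp_le_exp.2 <| neg_le_neg <|
    hmono (Subtype.coe_prop _) (Subtype.coe_prop _) (Set.monotone_projIcc zero_le_one hxy)
  have hint {S : W → ℝ} (hS : ∀ w, 0 ≤ S w) (hS1 : ∑ w, S w = 1) :
      ∫⁻ r, ENNReal.ofReal (Real.exp (-h r)) ∂μ1 S = ∫⁻ r, ENNReal.ofReal (f r) ∂μ1 S := by
    refine lintegral_congr_ae ?_
    filter_upwards [hae hS hS1] with r hr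
    simp only [f, Set.projIcc_of_mem zero_le_one hr]
  rw [hint hR hR1, hint hP hP1, hint hQ hQ1, ← smul_eq_mul, ← smul_eq_mul,
    ← lintegral_smul_measure, ← lintegral_smul_measure, ← lintegral_add_measure]
  have := hμprob _ hR hR1
  have := hμprob P hP hP1
  have := hμprob Q hQ hQ1
  refine hf.lintegral_ofReal_le (fun r ↦ ?_) fun r ↦ (Real.exp_pos _).le
  simp only [Measure.add_apply, Measure.smul_apply, smul_eq_mul]
  rcases lt_or_ge r 0 with hr0 | hr0
  · rw [measure_mono_null (Set.Iic_subset_Iic.2 hr0.le) (hzero hR hR1)]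
    exact zero_le
  rcases le_or_gt r 1 with hr1 | hr1
  · have hnn {S : W → ℝ} (hS : ∀ w, 0 ≤ S w) : 0 ≤ ∑ w, S w * r ^ (1 / S w) :=
      Finset.sum_nonneg fun w _ ↦ mul_nonneg (hS w) (Real.rpow_nonneg hr0 _)
    rw [hμcdf _ hR hR1 r ⟨hr0, hr1⟩, hμcdf P hP hP1 r ⟨hr0, hr1⟩, hμcdf Q hQ hQ1 r ⟨hr0, hr1⟩,
      ← ENNReal.ofReal_mul ht0, ← ENNReal.ofReal_mul (sub_nonneg.2 ht1),
      ← ENNReal.ofReal_add (mul_nonneg ht0 (hnn hP)) (mul_nonneg (sub_nonneg.2 ht1) (hnn hQ))]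
    refine ENNReal.ofReal_le_ofReal ?_
    rw [Finset.mul_sum, Finset.mul_sum, ← Finset.sum_add_distrib]
    exact Finset.sum_le_sum fun w _ ↦ (convexOn_mul_rpow_one_div hr0 hr1).2 (hP w) (hQ w) ht0
      (sub_nonneg.2 ht1) (add_sub_cancel t 1)
  · have hfull {S : W → ℝ} (hS : ∀ w, 0 ≤ S w) (hS1 : ∑ w, S w = 1) : 1 ≤ μ1 S (Set.Iic r) :=
      (hone hS hS1).ge.trans (measure_mono (Set.Iic_subset_Iic.2 hr1.le))
    calc μ1 (t • P + (1 - t) • Q) (Set.Iic r) ≤ 1 := prob_le_one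
      _ = ENNReal.ofReal t * 1 + ENNReal.ofReal (1 - t) * 1 := by
        rw [mul_one, mul_one, ← ENNReal.ofReal_add ht0 (sub_nonneg.2 ht1), add_sub_cancel,
          ENNReal.ofReal_one]
      _ ≤ _ := by
        gcongr
        · exact hfull hP hP1
        · exact hfull hQ hQ1
end

section
/- Let W be a finite vocabulary with |W| ≥ 2 and let 0 ≤ Δ ≤ 1 − 1/|W|. The set of extreme points of the compact convex set 𝒫_Δ = { P ∈ Simp(W) : max_w P_w ≤ 1−Δ } ⊆ ℝ^W is exactly { π(P*_Δ) : π a permutation of the coordinates of W }, where π(P) denotes the vector whose i-th coordinate is P_{π(i)}. -/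
/-- The simplex of probability vectors on `Fin m`. -/
def probSimplex (m : ℕ) : Set (Fin m → ℝ) :=
  {P | (∀ w, 0 ≤ P w) ∧ ∑ w, P w = 1}

/-- The `Δ`-regular class `𝒫_Δ = {P ∈ Simp : max_w P_w ≤ 1-Δ}`. -/
def regularClass (m : ℕ) (Δ : ℝ) : Set (Fin m → ℝ) :=
  {P | P ∈ probSimplex m ∧ ∀ w, P w ≤ 1 - Δ}

/-- The least-favorable distribution `P*_Δ`. -/
noncomputable def leastFavorable (m : ℕ) (Δ : ℝ) : Fin m → ℝ := fun i =>
  if (i : ℕ) < ⌊1 / (1 - Δ)⌋₊ then 1 - Δ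
  else if (i : ℕ) = ⌊1 / (1 - Δ)⌋₊ then 1 - (1 - Δ) * ⌊1 / (1 - Δ)⌋₊
  else 0

/-- The coordinates of `P` with at most one exception take one of the values `0`, `c`. -/
def AtMostOneFractional {ι : Type*} (c : ℝ) (P : ι → ℝ) : Prop :=
  ∀ i j, i ≠ j → (P i = 0 ∨ P i = c) ∨ (P j = 0 ∨ P j = c)

theorem comp_perm_mem_regularClass {m : ℕ} {Δ : ℝ} {P : Fin m → ℝ} (hP : P ∈ regularClass m Δ)
    (σ : Equiv.Perm (Fin m)) : P ∘ σ ∈ regularClass m Δ :=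
  ⟨⟨fun _ => hP.1.1 _, (Equiv.sum_comp σ P).trans hP.1.2⟩, fun _ => hP.2 _⟩

theorem AtMostOneFractional.comp_injective {ι κ : Type*} {c : ℝ} {P : ι → ℝ}
    (h : AtMostOneFractional c P) {f : κ → ι} (hf : f.Injective) :
    AtMostOneFractional c (P ∘ f) :=
  fun i j hij => h (f i) (f j) (hf.ne hij)

theorem eq_of_sum_eq_of_forall_ne {ι : Type*} [Fintype ι] [DecidableEq ι] {x y : ι → ℝ} (j : ι)
    (hsum : ∑ i, x i = ∑ i, y i) (h : ∀ i, i ≠ j → x i = y i) : x = y := by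
  have hj : x j = y j := by
    rw [← Finset.add_sum_erase _ x (Finset.mem_univ j),
      ← Finset.add_sum_erase _ y (Finset.mem_univ j),
      Finset.sum_congr rfl fun i hi => h i (Finset.ne_of_mem_erase hi)] at hsum
    exact add_right_cancel hsum
  funext i
  by_cases hi : i = j
  · rw [hi, hj]
  · exact h i hi

theorem AtMostOneFractional.mem_extremePoints {m : ℕ} {Δ : ℝ} {P : Fin m → ℝ}
    (hP : P ∈ regularClass m Δ) (h : AtMostOneFractional (1 - Δ) P) :
    P ∈ (regularClass m Δ).extremePoints ℝ := by
  refine ⟨hP, ?_⟩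
  rintro x hx y hy ⟨a, b, ha, hb, hab, rfl⟩
  set P := a • x + b • y with hPdef
  have key : ∀ i, (P i = 0 ∨ P i = 1 - Δ) → x i = P i := by
    intro i hi
    have hPi : P i = a * x i + b * y i := rfl
    have hx0 := hx.1.1 i
    have hy0 := hy.1.1 i
    have hx1 := hx.2 i
    have hy1 := hy.2 i
    obtain rfl : b = 1 - a := by linarith
    rcases hi with hi | hi
    · rw [hi] at hPi ⊢
      nlinarith [mul_nonneg ha.le hx0, mul_nonneg hb.le hy0]
    · rw [hi] at hPi ⊢
      nlinarith [mul_nonneg ha.le (sub_nonneg.2 hx1), mul_nonneg hb.le (sub_nonneg.2 hy1)]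
  by_cases hfrac : ∃ j, ¬(P j = 0 ∨ P j = 1 - Δ)
  · obtain ⟨j, hj⟩ := hfrac
    exact eq_of_sum_eq_of_forall_ne j (hx.1.2.trans hP.1.2.symm)
      fun i hi => key i ((h i j hi).resolve_right hj)
  · push Not at hfrac
    exact funext fun i => key i (hfrac i)

theorem add_transfer_mem_regularClass {m : ℕ} {Δ ε : ℝ} {P : Fin m → ℝ}
    (hP : P ∈ regularClass m Δ) {i j : Fin m} (hij : i ≠ j)
    (hi0 : 0 ≤ P i + ε) (hi1 : P i + ε ≤ 1 - Δ) (hj0 : 0 ≤ P j - ε) (hj1 : P j - ε ≤ 1 - Δ) :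
    P + (Pi.single i ε - Pi.single j ε) ∈ regularClass m Δ := by
  have hcoord : ∀ p : ℝ → Prop, (∀ w, p (P w)) → p (P i + ε) → p (P j - ε) →
      ∀ w, p ((P + (Pi.single i ε - Pi.single j ε) : Fin m → ℝ) w) := by
    intro p hp hpi hpj w
    by_cases hwi : w = i
    · subst hwi
      simpa [hij] using hpi
    · by_cases hwj : w = j
      · subst hwj
        simpa [hwi, sub_eq_add_neg] using hpj
      · simpa [hwi, hwj] using hp w
  refine ⟨⟨hcoord (0 ≤ ·) hP.1.1 hi0 hj0, ?_⟩, hcoord (· ≤ 1 - Δ) hP.2 hi1 hj1⟩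
  simp [Finset.sum_add_distrib, hP.1.2]

theorem atMostOneFractional_of_mem_extremePoints {m : ℕ} {Δ : ℝ} {P : Fin m → ℝ}
    (hP : P ∈ (regularClass m Δ).extremePoints ℝ) : AtMostOneFractional (1 - Δ) P := by
  intro i j hij
  by_contra! hfrac
  obtain ⟨⟨hi, hi'⟩, hj, hj'⟩ := hfrac
  have hPi := (hP.1.1.1 i).lt_of_ne' hi
  have hPj := (hP.1.1.1 j).lt_of_ne' hj
  have hPi' := (hP.1.2 i).lt_of_ne hi'
  have hPj' := (hP.1.2 j).lt_of_ne hj'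
  obtain ⟨ε, hε, hle⟩ : ∃ ε > 0, ε ≤ P i ∧ ε ≤ P j ∧ ε ≤ 1 - Δ - P i ∧ ε ≤ 1 - Δ - P j := by
    refine ⟨min (min (P i) (P j)) (min (1 - Δ - P i) (1 - Δ - P j)), ?_, ?_⟩
    · exact lt_min (lt_min hPi hPj) (lt_min (sub_pos.2 hPi') (sub_pos.2 hPj'))
    · simp
  obtain ⟨h1, h2, h3, h4⟩ := hle
  have hadd := add_transfer_mem_regularClass hP.1 hij (ε := ε)
    (by linarith) (by linarith) (by linarith) (by linarith)
  have hsub := add_transfer_mem_regularClass hP.1 hij (ε := -ε)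
    (by linarith) (by linarith) (by linarith) (by linarith)
  have hseg := hP.2 hadd hsub ⟨1 / 2, 1 / 2, by norm_num, by norm_num, by norm_num, by
    funext w
    simp only [Pi.single_neg, Pi.add_apply, Pi.smul_apply, Pi.sub_apply, Pi.neg_apply, smul_eq_mul]
    ring⟩
  have := congrFun hseg i
  simp [hij] at this
  exact hε.ne' this

theorem atMostOneFractional_leastFavorable (m : ℕ) (Δ : ℝ) :
    AtMostOneFractional (1 - Δ) (leastFavorable m Δ) := by
  have key : ∀ i : Fin m, (i : ℕ) ≠ ⌊1 / (1 - Δ)⌋₊ →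
      leastFavorable m Δ i = 0 ∨ leastFavorable m Δ i = 1 - Δ := by
    intro i hi
    unfold leastFavorable
    split_ifs <;> simp
  intro i j hij
  by_cases hi : (i : ℕ) = ⌊1 / (1 - Δ)⌋₊
  · exact Or.inr (key j fun hj => hij (Fin.ext (hi.trans hj.symm)))
  · exact Or.inl (key i hi)

theorem leastFavorable_remainder_nonneg {Δ : ℝ} (hΔ : Δ < 1) :
    0 ≤ 1 - (1 - Δ) * ⌊1 / (1 - Δ)⌋₊ := by
  have hc := sub_pos.2 hΔ
  have h := Nat.floor_le (one_div_pos.2 hc).le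
  rw [le_div_iff₀ hc] at h
  linarith

theorem leastFavorable_remainder_lt {Δ : ℝ} (hΔ : Δ < 1) :
    1 - (1 - Δ) * ⌊1 / (1 - Δ)⌋₊ < 1 - Δ := by
  have hc := sub_pos.2 hΔ
  have h := Nat.lt_floor_add_one (1 / (1 - Δ))
  rw [div_lt_iff₀ hc] at h
  linarith

theorem one_le_mul_of_le_one_sub_inv {m : ℕ} (hm : 0 < m) {Δ : ℝ} (hΔ : Δ ≤ 1 - 1 / m) :
    1 ≤ (1 - Δ) * m := by
  rw [← div_le_iff₀ (by exact_mod_cast hm)]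
  linarith

theorem sum_leastFavorable {m : ℕ} (hm : 0 < m) {Δ : ℝ} (hΔ : Δ ≤ 1 - 1 / m) (hΔ1 : Δ < 1) :
    ∑ i, leastFavorable m Δ i = 1 := by
  have hcm := one_le_mul_of_le_one_sub_inv hm hΔ
  have hr := leastFavorable_remainder_nonneg hΔ1
  have hk : ⌊1 / (1 - Δ)⌋₊ ≤ m := by
    refine Nat.floor_le_of_le ?_
    rw [div_le_iff₀ (sub_pos.2 hΔ1)]
    linarith
  unfold leastFavorable
  generalize ⌊1 / (1 - Δ)⌋₊ = k at *
  rw [Fin.sum_univ_eq_sum_range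
    (fun i => if i < k then 1 - Δ else if i = k then 1 - (1 - Δ) * k else 0) m,
    ← Finset.sum_range_add_sum_Ico _ hk,
    Finset.sum_congr rfl fun i hi => if_pos (Finset.mem_range.1 hi),
    Finset.sum_congr rfl fun i hi => if_neg (Finset.mem_Ico.1 hi).1.not_gt,
    Finset.sum_ite_eq']
  rcases hk.lt_or_eq with hlt | rfl
  · rw [if_pos (Finset.mem_Ico.2 ⟨le_rfl, hlt⟩), Finset.sum_const, Finset.card_range, nsmul_eq_mul]
    ring
  · rw [if_neg (by simp), Finset.sum_const, Finset.card_range, nsmul_eq_mul]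
    linarith

theorem leastFavorable_mem_regularClass {m : ℕ} (hm : 0 < m) {Δ : ℝ} (hΔ : Δ ≤ 1 - 1 / m)
    (hΔ1 : Δ < 1) : leastFavorable m Δ ∈ regularClass m Δ := by
  have hr := leastFavorable_remainder_nonneg hΔ1
  have hr' := leastFavorable_remainder_lt hΔ1
  refine ⟨⟨fun i => ?_, sum_leastFavorable hm hΔ hΔ1⟩, fun i => ?_⟩ <;>
    unfold leastFavorable <;> split_ifs <;> linarith

theorem AtMostOneFractional.eq_leastFavorable_of_antitone {m : ℕ} {Δ : ℝ} {Q : Fin m → ℝ}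
    (hQ : Q ∈ regularClass m Δ) (hfrac : AtMostOneFractional (1 - Δ) Q) (hanti : Antitone Q)
    (hL : leastFavorable m Δ ∈ regularClass m Δ) (hΔ1 : Δ < 1) : Q = leastFavorable m Δ := by
  have hsum : ∑ i, Q i = ∑ i, leastFavorable m Δ i := hQ.1.2.trans hL.1.2.symm
  have hzero : ∀ i l, i < l → Q i < 1 - Δ → Q l = 0 := by
    intro i l hil hi
    have hli := hanti hil.le
    rcases hfrac i l hil.ne with (h | h) | h | h
    · exact le_antisymm (hli.trans h.le) (hQ.1.1 l)
    · exact absurd h hi.ne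
    · exact h
    · linarith
  have hlow : ∀ i : Fin m, (i : ℕ) < ⌊1 / (1 - Δ)⌋₊ → Q i = leastFavorable m Δ i := by
    intro i hi
    have hLi : ∀ l ≤ i, leastFavorable m Δ l = 1 - Δ :=
      fun l hl => if_pos (lt_of_le_of_lt (Fin.le_def.1 hl) hi)
    rw [hLi i le_rfl]
    by_contra hne
    have hlt := (hQ.2 i).lt_of_ne hne
    refine hsum.not_lt (Finset.sum_lt_sum (fun l _ => ?_) ⟨i, Finset.mem_univ i, ?_⟩)
    · rcases le_or_gt l i with hl | hl
      · exact (hQ.2 l).trans (hLi l hl).ge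
      · exact (hzero i l hl hlt).le.trans (hL.1.1 l)
    · rwa [hLi i le_rfl]
  have hhigh : ∀ k i : Fin m, (k : ℕ) = ⌊1 / (1 - Δ)⌋₊ → k < i →
      Q i = leastFavorable m Δ i := by
    intro k i hk hki
    have hLi : ∀ l, k < l → leastFavorable m Δ l = 0 := fun l hl => by
      have : (k : ℕ) < l := hl
      simp only [leastFavorable, ← hk, this.not_gt, this.ne', if_false]
    have hLk : leastFavorable m Δ k < 1 - Δ := by
      have := leastFavorable_remainder_lt hΔ1
      simpa [leastFavorable, hk] using this
    rw [hLi i hki]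
    refine hzero k i hki ((hQ.2 k).lt_of_ne fun hQk => ?_)
    refine hsum.not_gt (Finset.sum_lt_sum (fun l _ => ?_) ⟨k, Finset.mem_univ k, ?_⟩)
    · rcases le_or_gt l k with hl | hl
      · exact (hL.2 l).trans (hQk.ge.trans (hanti hl))
      · exact (hLi l hl).le.trans (hQ.1.1 l)
    · rwa [hQk]
  by_cases hk : ⌊1 / (1 - Δ)⌋₊ < m
  · refine eq_of_sum_eq_of_forall_ne ⟨_, hk⟩ hsum fun i hi => ?_
    rcases lt_or_gt_of_ne hi with h | h
    · exact hlow i h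
    · exact hhigh ⟨_, hk⟩ i rfl h
  · exact funext fun i => hlow i (i.2.trans_le (not_lt.1 hk))

/-- The extreme points of the `Δ`-regular polytope `𝒫_Δ` are exactly the
coordinate permutations of the least-favorable distribution `P*_Δ`. -/
theorem regularClass_extremePoints
    (m : ℕ) (hm : 2 ≤ m) (Δ : ℝ) (hΔ0 : 0 ≤ Δ) (hΔ' : Δ ≤ 1 - 1 / m) :
    (regularClass m Δ).extremePoints ℝ
      = {Q | ∃ σ : Equiv.Perm (Fin m), Q = leastFavorable m Δ ∘ σ} := by
  have hm0 : 0 < m := by omega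
  have hΔ1 : Δ < 1 := by
    have : (0 : ℝ) < 1 / m := by positivity
    linarith
  have hL := leastFavorable_mem_regularClass hm0 hΔ' hΔ1
  ext P
  constructor
  · intro hP
    let σ := Tuple.sort fun i => -P i
    have hanti : Antitone (P ∘ σ) := fun i j hij =>
      neg_le_neg_iff.1 (Tuple.monotone_sort (fun i => -P i) hij)
    have h := ((atMostOneFractional_of_mem_extremePoints hP).comp_injective
      σ.injective).eq_leastFavorable_of_antitone (comp_perm_mem_regularClass hP.1 σ) hanti hL hΔ1
    refine ⟨σ⁻¹, ?_⟩
    rw [← h]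
    funext i
    simp
  · rintro ⟨σ, rfl⟩
    exact ((atMostOneFractional_leastFavorable m Δ).comp_injective σ.injective).mem_extremePoints
      (comp_perm_mem_regularClass hL σ)
end

section
/- Let W be a finite vocabulary, P ∈ Simp(W) with P_(1) := max_w P_w < 1, and let K = #{ w ∈ W : P_w > 0 } (so K ≥ 2). Define R_llr = −∫_0^1 log( Σ_{w : P_w > 0} r^{1/P_w − 1} ) dr and R_log = sup_{θ ∈ [0, 1/P_(1))} ( θ − log Σ_{w∈W} P_w/(1 − P_w θ) ). Then R_log ≤ R_llr, R_llr > 0, and R_log ≥ ( 1 − min{ (P_(1)/(1−P_(1)))·log(1/P_(1)), (K − 1/P_(1))/(K − 1 − log K) } ) · R_llr. -/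
open scoped ENNReal Classical

/-- The density of the Gumbel-max pivotal statistic, as a sum over the support `s` of `P`. -/
noncomputable def pivotDensity {W : Type*} (s : Finset W) (P : W → ℝ) (r : ℝ) : ℝ :=
  ∑ w ∈ s, r ^ (1 / P w - 1)

section

variable {W : Type*} {s : Finset W} {P : W → ℝ} {p : ℝ}

theorem pivotDensity_pos (hs : s.Nonempty) {r : ℝ} (hr : 0 < r) : 0 < pivotDensity s P r :=
  Finset.sum_pos (fun _ _ => Real.rpow_pos_of_pos hr _) hs

theorem rpow_le_pivotDensity {w : W} (hw : w ∈ s) {r : ℝ} (hr : 0 < r) :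
    r ^ (1 / P w - 1) ≤ pivotDensity s P r :=
  Finset.single_le_sum (f := fun v => r ^ (1 / P v - 1))
    (fun _ _ => (Real.rpow_pos_of_pos hr _).le) hw

theorem pivotDensity_le_card (hpos : ∀ w ∈ s, 0 < P w) (hle : ∀ w ∈ s, P w ≤ 1)
    {r : ℝ} (hr : 0 < r) (hr1 : r ≤ 1) : pivotDensity s P r ≤ s.card := by
  have h : pivotDensity s P r ≤ ∑ w ∈ s, (1 : ℝ) := by
    refine Finset.sum_le_sum fun w hw => Real.rpow_le_one hr.le hr1 ?_
    have := (one_le_div (hpos w hw)).2 (hle w hw)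
    linarith
  simpa using h

theorem mul_rpow_le_pivotDensity (hpos : ∀ w ∈ s, 0 < P w) (hle : ∀ w ∈ s, P w ≤ p)
    (hp : 0 < p) (hsum : ∑ w ∈ s, P w = 1) {r : ℝ} (hr : 0 < r) :
    1 / p * r ^ ((s.card : ℝ) - 1) ≤ pivotDensity s P r := by
  have hexp : ∑ w ∈ s, (1 / P w - 1) * P w = (s.card : ℝ) - 1 := by
    have : ∑ w ∈ s, (1 / P w - 1) * P w = ∑ w ∈ s, (1 - P w) :=
      Finset.sum_congr rfl fun w hw => by
        have := (hpos w hw).ne'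
        field_simp
    rw [this, Finset.sum_sub_distrib, hsum]
    simp
  have hgm := Real.geom_mean_le_arith_mean_weighted s P (fun w => r ^ (1 / P w - 1))
    (fun w hw => (hpos w hw).le) hsum (fun w _ => (Real.rpow_pos_of_pos hr _).le)
  have hprod : ∏ w ∈ s, (r ^ (1 / P w - 1)) ^ P w = r ^ ((s.card : ℝ) - 1) := by
    rw [← hexp, Real.rpow_sum_of_pos hr]
    exact Finset.prod_congr rfl fun w _ => (Real.rpow_mul hr.le _ _).symm
  rw [hprod] at hgm
  rw [one_div, inv_mul_le_iff₀ hp, pivotDensity, Finset.mul_sum]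
  refine hgm.trans (Finset.sum_le_sum fun w hw => ?_)
  exact mul_le_mul_of_nonneg_right (hle w hw) (Real.rpow_pos_of_pos hr _).le

theorem intervalIntegrable_log_pivotDensity (hs : s.Nonempty) (hpos : ∀ w ∈ s, 0 < P w)
    (hle : ∀ w ∈ s, P w ≤ 1) :
    IntervalIntegrable (fun r => Real.log (pivotDensity s P r)) MeasureTheory.volume 0 1 := by
  obtain ⟨w, hw⟩ := hs
  have hdom : IntervalIntegrable
      (fun r => |(1 / P w - 1) * Real.log r| + Real.log s.card) MeasureTheory.volume 0 1 :=
    ((intervalIntegral.intervalIntegrable_log'.const_mul _).abs).add intervalIntegrable_const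
  refine hdom.mono_fun' ?_ ?_
  · refine (Real.measurable_log.comp ?_).aestronglyMeasurable
    exact Finset.measurable_sum _ fun _ _ => measurable_id.pow_const _
  · rw [Set.uIoc_of_le zero_le_one]
    filter_upwards [MeasureTheory.ae_restrict_mem measurableSet_Ioc] with r hr
    have h1 := Real.log_le_log (Real.rpow_pos_of_pos hr.1 _) (rpow_le_pivotDensity (P := P) hw hr.1)
    rw [Real.log_rpow hr.1] at h1
    have h2 := Real.log_le_log (pivotDensity_pos (P := P) ⟨w, hw⟩ hr.1)
      (pivotDensity_le_card hpos hle hr.1 hr.2)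
    have h3 : 0 ≤ Real.log s.card := Real.log_natCast_nonneg _
    rw [Real.norm_eq_abs, abs_le]
    constructor
    · linarith [neg_abs_le ((1 / P w - 1) * Real.log r)]
    · linarith [abs_nonneg ((1 / P w - 1) * Real.log r)]

theorem integral_log_zero_one : ∫ r in (0 : ℝ)..1, Real.log r = -1 := by
  simp

theorem neg_integral_log_pivotDensity_le (hs : s.Nonempty) (hpos : ∀ w ∈ s, 0 < P w)
    (hle : ∀ w ∈ s, P w ≤ 1) {b c : ℝ}
    (h : ∀ r ∈ Set.Ioo (0 : ℝ) 1, b + c * Real.log r ≤ Real.log (pivotDensity s P r)) :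
    -∫ r in (0 : ℝ)..1, Real.log (pivotDensity s P r) ≤ c - b := by
  have hint : IntervalIntegrable (fun r => c * Real.log r) MeasureTheory.volume 0 1 :=
    intervalIntegral.intervalIntegrable_log'.const_mul _
  have := intervalIntegral.integral_mono_on_of_le_Ioo zero_le_one
    (intervalIntegrable_const.add hint) (intervalIntegrable_log_pivotDensity hs hpos hle) h
  rw [intervalIntegral.integral_add intervalIntegrable_const hint,
    intervalIntegral.integral_const_mul, integral_log_zero_one] at this
  simp at this
  linarith

/-- Gibbs' variational inequality for the exponential tilts of the pivotal density. -/
theorem sub_log_sum_le_neg_integral_log (hs : s.Nonempty) (hpos : ∀ w ∈ s, 0 < P w)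
    (hle : ∀ w ∈ s, P w ≤ 1) {θ : ℝ} (hθ : ∀ w ∈ s, P w * θ < 1) :
    θ - Real.log (∑ w ∈ s, P w / (1 - P w * θ))
      ≤ -∫ r in (0 : ℝ)..1, Real.log (pivotDensity s P r) := by
  set M := ∑ w ∈ s, P w / (1 - P w * θ) with hM
  have hMpos : 0 < M :=
    Finset.sum_pos (fun w hw => div_pos (hpos w hw) (sub_pos.2 (hθ w hw))) hs
  have hexp : ∀ w ∈ s, -1 < 1 / P w - 1 - θ := fun w hw => by
    have := (lt_div_iff₀' (hpos w hw)).2 (hθ w hw)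
    linarith
  have hint : ∀ w ∈ s, IntervalIntegrable (fun r : ℝ => r ^ (1 / P w - 1 - θ))
      MeasureTheory.volume 0 1 :=
    fun w hw => intervalIntegral.intervalIntegrable_rpow' (hexp w hw)
  have hintsum : IntervalIntegrable (fun r : ℝ => ∑ w ∈ s, r ^ (1 / P w - 1 - θ))
      MeasureTheory.volume 0 1 := by
    simpa only [Finset.sum_fn] using IntervalIntegrable.sum s hint
  have htilt : ∫ r in (0 : ℝ)..1, ∑ w ∈ s, r ^ (1 / P w - 1 - θ) = M := by
    rw [intervalIntegral.integral_finsetSum hint]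
    refine Finset.sum_congr rfl fun w hw => ?_
    have h1 := hexp w hw
    have h2 := (hpos w hw).ne'
    have h3 := (sub_pos.2 (hθ w hw)).ne'
    rw [integral_rpow (Or.inl h1), Real.one_rpow, Real.zero_rpow (by linarith), sub_zero,
      show 1 / P w - 1 - θ + 1 = (1 - P w * θ) / P w by field_simp; ring, one_div_div]
  have hmono : ∀ r ∈ Set.Ioo (0 : ℝ) 1, Real.log (pivotDensity s P r) ≤
      (1 / M) * (∑ w ∈ s, r ^ (1 / P w - 1 - θ)) + (Real.log M - 1 + θ * Real.log r) := by
    intro r hr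
    have hf := pivotDensity_pos (P := P) hs hr.1
    have hfactor : ∑ w ∈ s, r ^ (1 / P w - 1 - θ) = pivotDensity s P r / r ^ θ := by
      rw [pivotDensity, Finset.sum_div]
      exact Finset.sum_congr rfl fun w _ => Real.rpow_sub hr.1 _ _
    have hrθ := Real.rpow_pos_of_pos hr.1 θ
    have := Real.log_le_sub_one_of_pos (div_pos (div_pos hf hrθ) hMpos)
    rw [Real.log_div (div_pos hf hrθ).ne' hMpos.ne', Real.log_div hf.ne' hrθ.ne',
      Real.log_rpow hr.1] at this
    rw [hfactor, one_div_mul_eq_div]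
    linarith
  have hlog : IntervalIntegrable (fun r => θ * Real.log r) MeasureTheory.volume 0 1 :=
    intervalIntegral.intervalIntegrable_log'.const_mul _
  have := intervalIntegral.integral_mono_on_of_le_Ioo zero_le_one
    (intervalIntegrable_log_pivotDensity hs hpos hle)
    ((hintsum.const_mul (1 / M)).add (intervalIntegrable_const.add hlog)) hmono
  rw [intervalIntegral.integral_add (hintsum.const_mul (1 / M))
      (intervalIntegrable_const.add hlog),
    intervalIntegral.integral_add intervalIntegrable_const hlog,
    intervalIntegral.integral_const_mul, intervalIntegral.integral_const_mul, htilt,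
    integral_log_zero_one, one_div_mul_cancel hMpos.ne', intervalIntegral.integral_const] at this
  simp only [sub_zero, one_smul] at this
  linarith

end

/-- Efficiency gap bound for the Gumbel-max watermark: with `R_llr` the efficiency
rate of the log-likelihood-ratio score and `R_log` that of `h_log(y) = log y`,
one has `R_log ≤ R_llr`, `R_llr > 0`, and the relative gap bound. -/
theorem gumbel_efficiency_gap {W : Type*} [Fintype W] [Nonempty W]
    (P : W → ℝ) (hnn : ∀ w, 0 ≤ P w) (hsum : ∑ w, P w = 1)
    (P1 : ℝ) (hmax : IsGreatest (Set.range P) P1) (hP1 : P1 < 1)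
    (K : ℕ) (hK : K = Set.ncard {w | 0 < P w})
    (Rllr Rlog : ℝ)
    (hllr : Rllr
      = -∫ r in (0:ℝ)..1, Real.log (∑ w, if 0 < P w then r ^ (1 / P w - 1) else 0))
    (hlog : Rlog = sSup {x : ℝ | ∃ θ : ℝ, 0 ≤ θ ∧ θ < 1 / P1 ∧
      x = θ - Real.log (∑ w, P w / (1 - P w * θ))}) :
    Rlog ≤ Rllr ∧ 0 < Rllr ∧
      (1 - min ((P1 / (1 - P1)) * Real.log (1 / P1))
          (((K : ℝ) - 1 / P1) / ((K : ℝ) - 1 - Real.log K))) * Rllr ≤ Rlog := by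
  classical
  obtain ⟨⟨w₀, hw₀⟩, hub⟩ := hmax
  have hle : ∀ w, P w ≤ P1 := fun w => hub ⟨w, rfl⟩
  set s : Finset W := Finset.univ.filter fun w => 0 < P w with hs
  have hpos : ∀ w ∈ s, 0 < P w := fun w hw => (Finset.mem_filter.1 hw).2
  have hle1 : ∀ w ∈ s, P w ≤ 1 := fun w _ => (hle w).trans hP1.le
  have hsupp : ∀ g : W → ℝ, (∀ w, P w = 0 → g w = 0) → ∑ w, g w = ∑ w ∈ s, g w := by
    intro g hg
    refine (Finset.sum_subset (Finset.subset_univ s) fun w _ hw => hg w ?_).symm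
    exact le_antisymm (not_lt.1 fun h => hw (by simp [hs, h])) (hnn w)
  have hsum' : ∑ w ∈ s, P w = 1 := by rw [← hsupp P fun _ h => h, hsum]
  have hne : s.Nonempty := by
    by_contra h
    simp [Finset.not_nonempty_iff_eq_empty.1 h] at hsum'
  have hp : 0 < P1 := by
    obtain ⟨w, hw⟩ := hne
    exact (hpos w hw).trans_le (hle w)
  have hw₀s : w₀ ∈ s := by simp [hs, hw₀, hp]
  have hKcard : K = s.card := by
    rw [hK, ← Set.ncard_coe_finset]
    simp [hs]
  have hllr' : Rllr = -∫ r in (0 : ℝ)..1, Real.log (pivotDensity s P r) := by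
    simp only [hllr, pivotDensity, hs, Finset.sum_filter]
  have ha : 1 < 1 / P1 := (one_lt_div hp).2 hP1
  have haK : 1 / P1 ≤ K := by
    rw [div_le_iff₀ hp, hKcard, ← hsum', ← nsmul_eq_mul]
    exact Finset.sum_le_card_nsmul _ _ _ fun w _ => hle w
  have hlog_u : Rllr ≤ 1 / P1 - 1 := by
    rw [hllr', ← sub_zero (1 / P1 - 1)]
    refine neg_integral_log_pivotDensity_le hne hpos hle1 fun r hr => ?_
    rw [zero_add, ← Real.log_rpow hr.1, ← hw₀]
    exact Real.log_le_log (Real.rpow_pos_of_pos hr.1 _) (rpow_le_pivotDensity hw₀s hr.1)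
  have hlog_K : Rllr ≤ K - 1 - Real.log (1 / P1) := by
    rw [hllr', hKcard]
    refine neg_integral_log_pivotDensity_le hne hpos hle1 fun r hr => ?_
    rw [← Real.log_rpow hr.1, ← Real.log_mul (by positivity) (Real.rpow_pos_of_pos hr.1 _).ne']
    exact Real.log_le_log (mul_pos (by positivity) (Real.rpow_pos_of_pos hr.1 _))
      (mul_rpow_le_pivotDensity hpos (fun w _ => hle w) hp hsum' hr.1)
  have hbound : ∀ x ∈ {x : ℝ | ∃ θ : ℝ, 0 ≤ θ ∧ θ < 1 / P1 ∧
      x = θ - Real.log (∑ w, P w / (1 - P w * θ))}, x ≤ Rllr := by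
    rintro x ⟨θ, hθ0, hθ, rfl⟩
    rw [hsupp _ fun w h => by simp [h], hllr']
    refine sub_log_sum_le_neg_integral_log hne hpos hle1 fun w _ => ?_
    exact (mul_le_mul_of_nonneg_right (hle w) hθ0).trans_lt ((lt_div_iff₀' hp).1 hθ)
  have hR : Rlog ≤ Rllr := by
    rw [hlog]
    exact csSup_le ⟨_, 0, le_rfl, by positivity, rfl⟩ hbound
  have hlow : 1 / P1 - 1 - Real.log (1 / P1) ≤ Rlog := by
    have hmem : 1 / P1 - 1 - Real.log (∑ w, P w / (1 - P w * (1 / P1 - 1))) ≤ Rlog := by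
      rw [hlog]
      exact le_csSup ⟨Rllr, hbound⟩ ⟨1 / P1 - 1, by linarith, by linarith, rfl⟩
    have hden : ∀ w, P1 ≤ 1 - P w * (1 / P1 - 1) := fun w => by
      have h1 := mul_le_mul_of_nonneg_right (hle w) (sub_pos.2 ha).le
      have h2 : P1 * (1 / P1 - 1) = 1 - P1 := by field_simp
      linarith
    have hA : ∑ w, P w / (1 - P w * (1 / P1 - 1)) ≤ 1 / P1 := by
      refine le_of_le_of_eq ?_ (show ∑ w, P w / P1 = 1 / P1 by rw [← Finset.sum_div, hsum])
      exact Finset.sum_le_sum fun w _ => div_le_div_of_nonneg_left (hnn w) hp (hden w)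
    have hApos : 0 < ∑ w, P w / (1 - P w * (1 / P1 - 1)) :=
      Finset.sum_pos' (fun w _ => div_nonneg (hnn w) (hp.le.trans (hden w)))
        ⟨w₀, Finset.mem_univ _, div_pos (hpos w₀ hw₀s) (hp.trans_le (hden w₀))⟩
    linarith [Real.log_le_log hApos hA]
  have hloga : 0 < 1 / P1 - 1 - Real.log (1 / P1) :=
    sub_pos.2 (Real.log_lt_sub_one_of_pos (by positivity) ha.ne')
  have hRpos : 0 < Rllr := by linarith
  refine ⟨hR, hRpos, ?_⟩
  have hKpos : (0 : ℝ) < K - 1 - Real.log K :=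
    sub_pos.2 (Real.log_lt_sub_one_of_pos (by linarith) (by linarith))
  have hlogle : Real.log (1 / P1) ≤ Real.log K := Real.log_le_log (by positivity) haK
  rcases min_choice ((P1 / (1 - P1)) * Real.log (1 / P1))
      (((K : ℝ) - 1 / P1) / ((K : ℝ) - 1 - Real.log K)) with h | h <;> rw [h]
  · have hc : P1 / (1 - P1) = 1 / (1 / P1 - 1) := by
      rw [div_sub_one hp.ne', one_div_div]
    have hx : 0 < 1 / P1 - 1 := sub_pos.2 ha
    rw [hc, one_div_mul_eq_div, one_sub_div hx.ne', div_mul_eq_mul_div, div_le_iff₀ hx]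
    exact mul_le_mul hlow hlog_u hRpos.le (hloga.le.trans hlow)
  · rw [one_sub_div hKpos.ne', div_mul_eq_mul_div, div_le_iff₀ hKpos]
    rcases le_total (1 / P1 - 1 - Real.log K) 0 with h0 | h0
    · have h1 : (1 / P1 - 1 - Real.log K) * Rllr ≤ 0 := mul_nonpos_of_nonpos_of_nonneg h0 hRpos.le
      have h2 : 0 ≤ Rlog * (K - 1 - Real.log K) := mul_nonneg (hloga.le.trans hlow) hKpos.le
      linarith
    · have h1 := mul_le_mul_of_nonneg_left hlog_K h0
      have h2 := mul_le_mul_of_nonneg_right hlow hKpos.le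
      have h3 := mul_nonneg (sub_nonneg.2 haK) (sub_nonneg.2 hlogle)
      linarith
end

section
/- Let W be a finite vocabulary and P ∈ Simp(W) a probability vector with support S = { w : P_w > 0 } of size K = |S| ≥ 1. Then 0 ≤ −∫_0^1 log( Σ_{w∈S} r^{1/P_w − 1} ) dr ≤ K − 1 − log K. Moreover, the left-hand inequality is an equality when P_w = 1 for some w, and the right-hand inequality is an equality when P_w = 1/K for every w ∈ S. -/
open scoped Classical

namespace GumbelKL

open Real Finset MeasureTheory

lemma exp_sqrt_sub_one_le_cosh {b : ℝ} (hb : 0 ≤ b) : exp (√(1 + b ^ 2) - 1) ≤ cosh b := by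
  have hpos : ∀ x : ℝ, 0 < 1 + x ^ 2 := fun x => by positivity
  have hd : ∀ x : ℝ, HasDerivAt (fun x => log (cosh x) - √(1 + x ^ 2))
      (sinh x / cosh x - x / √(1 + x ^ 2)) x := by
    intro x
    have h1 := (hasDerivAt_cosh x).log (cosh_pos x).ne'
    have h2 : HasDerivAt (fun x : ℝ => √(1 + x ^ 2)) (2 * x / (2 * √(1 + x ^ 2))) x := by
      simpa using (((hasDerivAt_pow 2 x).const_add 1).sqrt (hpos x).ne')
    rw [mul_div_mul_left _ _ two_ne_zero] at h2
    exact h1.sub h2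
  have hmono : MonotoneOn (fun x => log (cosh x) - √(1 + x ^ 2)) (Set.Ici 0) := by
    refine monotoneOn_of_deriv_nonneg (convex_Ici 0)
      (fun x _ => (hd x).continuousAt.continuousWithinAt)
      (fun x _ => (hd x).differentiableAt.differentiableWithinAt) ?_
    intro x hx
    rw [interior_Ici] at hx
    have hx0 : 0 < x := hx
    rw [(hd x).deriv, sub_nonneg, div_le_div_iff₀ (sqrt_pos.2 (hpos x)) (cosh_pos x)]
    have hs : x ≤ sinh x := self_le_sinh_iff.2 hx0.le
    refine abs_le_of_sq_le_sq' ?_ (by positivity) |>.2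
    rw [mul_pow, mul_pow, sq_sqrt (hpos x).le, cosh_sq]
    nlinarith
  have h := hmono (Set.mem_Ici.2 le_rfl) (Set.mem_Ici.2 hb) hb
  simp only [cosh_zero, log_one] at h
  norm_num at h
  rw [← le_log_iff_exp_le (cosh_pos b)]
  linarith

lemma two_mul_exp_le_of_add_eq_one {p q : ℝ} (hp : 0 < p) (hq : 0 < q) (hpq : p + q = 1) :
    2 * exp (1 - 2) ≤ exp (1 - 1 / p) + exp (1 - 1 / q) := by
  wlog hle : q ≤ p generalizing p q
  · rw [add_comm]
    exact this hq hp (by linarith) (by linarith)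
  set b := (p - q) / (2 * p * q) with hb
  have hb0 : 0 ≤ b := div_nonneg (by linarith) (by positivity)
  have hsqrt : √(1 + b ^ 2) = 1 / (2 * p * q) - 1 := by
    have hnn : 0 ≤ 1 / (2 * p * q) - 1 := by
      rw [sub_nonneg, le_div_iff₀ (by positivity)]
      nlinarith [sq_nonneg (p - q)]
    rw [← sqrt_sq hnn]
    congr 1
    rw [hb]
    have : q = 1 - p := by linarith
    subst this
    field_simp
    ring
  have h := exp_sqrt_sub_one_le_cosh hb0
  rw [hsqrt, cosh_eq] at h
  have e1 : exp (1 - 1 / p) = exp (1 - 1 / (2 * p * q)) * exp b := by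
    rw [← exp_add]
    congr 1
    rw [hb]
    have : q = 1 - p := by linarith
    subst this
    field_simp
    ring
  have e2 : exp (1 - 1 / q) = exp (1 - 1 / (2 * p * q)) * exp (-b) := by
    rw [← exp_add]
    congr 1
    rw [hb]
    have : q = 1 - p := by linarith
    subst this
    field_simp
    ring
  have e3 : exp (1 - 2) = exp (1 - 1 / (2 * p * q)) * exp (1 / (2 * p * q) - 1 - 1) := by
    rw [← exp_add]
    congr 1
    ring
  rw [e1, e2, e3]
  have := mul_le_mul_of_nonneg_left h (exp_pos (1 - 1 / (2 * p * q))).le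
  linarith

lemma add_mul_le_exp_mul_sub {K u : ℝ} (hK : 3 ≤ K) (hu : u ≤ K - 1) :
    K + (K - 1) * u ≤ exp u * (K - u) := by
  rcases le_total 0 u with h0 | h0
  · have h := sum_le_exp_of_nonneg h0 5
    simp only [sum_range_succ, sum_range_zero, Nat.factorial] at h
    norm_num at h
    have hrem : 0 ≤ 3 * (K - 2) - 3 * u + u * (K - u) + u ^ 2 * (K - u) / 4 := by
      rcases le_total u 2 with h2 | h2
      · nlinarith [mul_nonneg h0 (sub_nonneg.2 hK), mul_nonneg (sq_nonneg u) (sub_nonneg.2 hK),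
          mul_nonneg h0 (sub_nonneg.2 h2), mul_nonneg (sq_nonneg u) (sub_nonneg.2 h2)]
      · nlinarith [mul_nonneg h0 (sub_nonneg.2 hu), mul_nonneg (sq_nonneg u) (sub_nonneg.2 hu)]
    have h' := mul_le_mul_of_nonneg_right h (by linarith : 0 ≤ K - u)
    nlinarith [mul_nonneg (sq_nonneg u) hrem]
  · rcases le_total (K + (K - 1) * u) 0 with h1 | h1
    · exact h1.trans (mul_nonneg (exp_pos u).le (by linarith))
    · have hu2 : -(3 / 2) ≤ u := by nlinarith
      have h : (1 + u / 3) ^ 3 ≤ exp u := by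
        calc (1 + u / 3) ^ 3 ≤ exp (u / 3) ^ 3 :=
              pow_le_pow_left₀ (by linarith) (by linarith [add_one_le_exp (u / 3)]) 3
          _ = exp u := by
              rw [← exp_nat_mul]
              congr 1
              push_cast
              ring
      have hrem : 0 ≤ 9 * (K - 3) - (9 - K) * u - u ^ 2 := by
        nlinarith [mul_nonneg (sub_nonneg.2 hK) (by linarith : 0 ≤ 9 + u)]
      have h' := mul_le_mul_of_nonneg_right h (by linarith : 0 ≤ K - u)
      nlinarith [mul_nonneg (sq_nonneg u) hrem]

lemma tangent_le_exp {K p : ℝ} (hK : 3 ≤ K) (hp : 0 < p) (hp1 : p ≤ 1) :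
    exp (1 - K) * (1 - K + K ^ 2 * p) ≤ exp (1 - 1 / p) := by
  have h1 : 1 ≤ 1 / p := by rwa [le_div_iff₀ hp, one_mul]
  have h := add_mul_le_exp_mul_sub hK (u := K - 1 / p) (by linarith)
  have e : exp (1 - 1 / p) = exp (1 - K) * exp (K - 1 / p) := by
    rw [← exp_add]
    congr 1
    ring
  rw [e]
  refine mul_le_mul_of_nonneg_left ?_ (exp_pos _).le
  have h' := mul_le_mul_of_nonneg_left h hp.le
  have e1 : p * (K + (K - 1) * (K - 1 / p)) = 1 - K + K ^ 2 * p := by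
    field_simp
    ring
  have e2 : p * (exp (K - 1 / p) * (K - (K - 1 / p))) = exp (K - 1 / p) := by
    field_simp
    ring
  rwa [e1, e2] at h'

variable {W : Type*} {S : Finset W} {P : W → ℝ}

lemma card_mul_exp_le_sum_exp (hpos : ∀ w ∈ S, 0 < P w) (hsum : ∑ w ∈ S, P w = 1) :
    #S * exp (1 - #S) ≤ ∑ w ∈ S, exp (1 - 1 / P w) := by
  classical
  have hle : ∀ w ∈ S, P w ≤ 1 := fun w hw =>
    hsum ▸ single_le_sum (fun i hi => (hpos i hi).le) hw
  rcases Nat.lt_or_ge (#S) 3 with h | h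
  · interval_cases hc : #S
    · simp [card_eq_zero.1 hc]
    · obtain ⟨a, rfl⟩ := card_eq_one.1 hc
      rw [sum_singleton] at hsum ⊢
      simp [hsum]
    · obtain ⟨a, b, hab, rfl⟩ := card_eq_two.1 hc
      rw [sum_pair hab] at hsum ⊢
      have := two_mul_exp_le_of_add_eq_one (hpos a (by simp)) (hpos b (by simp)) hsum
      exact_mod_cast this
  · have hK : (3 : ℝ) ≤ #S := by exact_mod_cast h
    calc (#S : ℝ) * exp (1 - #S) = ∑ w ∈ S, exp (1 - #S) * (1 - #S + (#S : ℝ) ^ 2 * P w) := by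
          rw [← mul_sum, sum_add_distrib, ← mul_sum, hsum, sum_const, nsmul_eq_mul]
          ring
      _ ≤ _ := sum_le_sum fun w hw => tangent_le_exp hK (hpos w hw) (hle w hw)

/-- The density of the Gumbel-max pivot, supported on `S`. -/
noncomputable def density (S : Finset W) (P : W → ℝ) (r : ℝ) : ℝ := ∑ w ∈ S, r ^ (1 / P w - 1)

lemma density_pos (hS : S.Nonempty) {r : ℝ} (hr : 0 < r) : 0 < density S P r :=
  sum_pos (fun _ _ => rpow_pos_of_pos hr _) hS

lemma intervalIntegrable_density (hpos : ∀ w ∈ S, 0 < P w) :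
    IntervalIntegrable (density S P) volume 0 1 := by
  have : density S P = ∑ w ∈ S, fun r : ℝ => r ^ (1 / P w - 1) := by
    ext r
    simp [density]
  rw [this]
  refine IntervalIntegrable.sum _ fun w hw => intervalIntegral.intervalIntegrable_rpow' ?_
  have := one_div_pos.2 (hpos w hw)
  linarith

lemma integral_density (hpos : ∀ w ∈ S, 0 < P w) :
    ∫ r in (0 : ℝ)..1, density S P r = ∑ w ∈ S, P w := by
  have hexp : ∀ w ∈ S, -1 < 1 / P w - 1 := fun w hw => by
    have := one_div_pos.2 (hpos w hw)
    linarith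
  unfold density
  rw [intervalIntegral.integral_finsetSum
    fun w hw => intervalIntegral.intervalIntegrable_rpow' (hexp w hw)]
  refine sum_congr rfl fun w hw => ?_
  have := (hpos w hw).ne'
  rw [integral_rpow (Or.inl (hexp w hw))]
  simp [this]

/-- Jensen's inequality: `t ↦ log (density S P (exp t))` lies above its tangent at `t = -1`. -/
lemma exists_tangent_le_log_density (hS : S.Nonempty) :
    ∃ c : ℝ, ∀ r : ℝ, 0 < r →
      log (∑ w ∈ S, exp (1 - 1 / P w)) + c * (log r + 1) ≤ log (density S P r) := by
  set Z := ∑ w ∈ S, exp (1 - 1 / P w) with hZ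
  have hZ0 : 0 < Z := sum_pos (fun _ _ => exp_pos _) hS
  refine ⟨∑ w ∈ S, exp (1 - 1 / P w) / Z * (1 / P w - 1), fun r hr => ?_⟩
  have h := convexOn_exp.map_sum_le (t := S) (w := fun w => exp (1 - 1 / P w) / Z)
    (p := fun w => (1 / P w - 1) * (log r + 1)) (fun w _ => by positivity)
    (by rw [← sum_div, div_self hZ0.ne']) (fun _ _ => Set.mem_univ _)
  simp only [smul_eq_mul] at h
  have e : ∑ w ∈ S, exp (1 - 1 / P w) / Z * exp ((1 / P w - 1) * (log r + 1))
      = density S P r / Z := by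
    rw [density, sum_div]
    refine sum_congr rfl fun w _ => ?_
    rw [div_mul_eq_mul_div, ← exp_add, rpow_def_of_pos hr]
    congr 2
    ring
  rw [e, ← le_log_iff_exp_le (div_pos (density_pos hS hr) hZ0),
    log_div (density_pos hS hr).ne' hZ0.ne'] at h
  rw [sum_mul]
  simp only [← mul_assoc] at h
  linarith

lemma intervalIntegrable_const_add_mul_log (a c : ℝ) :
    IntervalIntegrable (fun r => a + c * (log r + 1)) volume 0 1 :=
  intervalIntegrable_const.add
    ((intervalIntegral.intervalIntegrable_log'.add intervalIntegrable_const).const_mul c)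

lemma integral_const_add_mul_log (a c : ℝ) :
    ∫ r in (0 : ℝ)..1, (a + c * (log r + 1)) = a := by
  rw [intervalIntegral.integral_add intervalIntegrable_const
    ((intervalIntegral.intervalIntegrable_log'.add intervalIntegrable_const).const_mul c),
    intervalIntegral.integral_const_mul,
    intervalIntegral.integral_add intervalIntegral.intervalIntegrable_log' intervalIntegrable_const,
    integral_log]
  simp

lemma intervalIntegrable_log_density (hpos : ∀ w ∈ S, 0 < P w) (hS : S.Nonempty) :
    IntervalIntegrable (fun r => log (density S P r)) volume 0 1 := by
  obtain ⟨c, hc⟩ := exists_tangent_le_log_density (P := P) hS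
  have hl := intervalIntegrable_const_add_mul_log (log (∑ w ∈ S, exp (1 - 1 / P w))) c
  have hmeas : Measurable (density S P) :=
    Finset.measurable_sum _ fun w _ => measurable_id.pow_const _
  refine (hl.abs.add (intervalIntegrable_density hpos)).mono_fun'
    (measurable_log.comp hmeas).aestronglyMeasurable ?_
  rw [Set.uIoc_of_le zero_le_one]
  filter_upwards [ae_restrict_mem measurableSet_Ioc] with r hr
  have h1 := hc r hr.1
  have hf := density_pos (P := P) hS hr.1
  have h2 := log_le_sub_one_of_pos hf
  rw [norm_eq_abs, abs_le]
  constructor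
  · have := neg_abs_le (log (∑ w ∈ S, exp (1 - 1 / P w)) + c * (log r + 1))
    linarith
  · have := abs_nonneg (log (∑ w ∈ S, exp (1 - 1 / P w)) + c * (log r + 1))
    linarith

lemma nonempty_of_sum_eq_one (hsum : ∑ w ∈ S, P w = 1) : S.Nonempty :=
  nonempty_of_sum_ne_zero (hsum ▸ one_ne_zero)

theorem neg_integral_log_density_nonneg (hpos : ∀ w ∈ S, 0 < P w) (hsum : ∑ w ∈ S, P w = 1) :
    0 ≤ -∫ r in (0 : ℝ)..1, log (density S P r) := by
  have hS := nonempty_of_sum_eq_one hsum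
  have h := intervalIntegral.integral_mono_on_of_le_Ioo zero_le_one
    (intervalIntegrable_log_density hpos hS)
    ((intervalIntegrable_density hpos).sub (intervalIntegrable_const (c := (1 : ℝ))))
    fun r hr => log_le_sub_one_of_pos (density_pos hS hr.1)
  rw [intervalIntegral.integral_sub (intervalIntegrable_density hpos) intervalIntegrable_const,
    integral_density hpos, hsum] at h
  simp only [intervalIntegral.integral_const, sub_zero, smul_eq_mul, mul_one, sub_self] at h
  linarith

theorem neg_integral_log_density_le (hpos : ∀ w ∈ S, 0 < P w) (hsum : ∑ w ∈ S, P w = 1) :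
    -∫ r in (0 : ℝ)..1, log (density S P r) ≤ #S - 1 - log #S := by
  have hS := nonempty_of_sum_eq_one hsum
  obtain ⟨c, hc⟩ := exists_tangent_le_log_density (P := P) hS
  have h := intervalIntegral.integral_mono_on_of_le_Ioo zero_le_one
    (intervalIntegrable_const_add_mul_log _ c) (intervalIntegrable_log_density hpos hS)
    fun r hr => hc r hr.1
  rw [integral_const_add_mul_log] at h
  have hcard : (0 : ℝ) < #S := by exact_mod_cast hS.card_pos
  have hlog := log_le_log (by positivity) (card_mul_exp_le_sum_exp hpos hsum)
  rw [log_mul hcard.ne' (exp_pos _).ne', log_exp] at hlog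
  linarith

theorem neg_integral_log_density_eq (hS : S.Nonempty) (hunif : ∀ w ∈ S, P w = 1 / #S) :
    -∫ r in (0 : ℝ)..1, log (density S P r) = #S - 1 - log #S := by
  have hcard : (0 : ℝ) < #S := by exact_mod_cast hS.card_pos
  have h : ∫ r in (0 : ℝ)..1, log (density S P r)
      = ∫ r in (0 : ℝ)..1, ((log #S - (#S - 1)) + (#S - 1) * (log r + 1)) := by
    refine intervalIntegral.integral_congr_ae (ae_of_all _ fun r hr => ?_)
    rw [Set.uIoc_of_le zero_le_one] at hr
    have e : density S P r = #S * r ^ ((#S : ℝ) - 1) := by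
      rw [density, sum_congr rfl fun w hw => by rw [hunif w hw, one_div_one_div], sum_const,
        nsmul_eq_mul]
    rw [e, log_mul hcard.ne' (rpow_pos_of_pos hr.1 _).ne', log_rpow hr.1]
    ring
  rw [h, integral_const_add_mul_log]
  ring

end GumbelKL

/-- KL-divergence bounds for the Gumbel-max pivot: with `S = {w : P_w > 0}` of size
`K`, one has `0 ≤ -∫_0^1 log(Σ_{w∈S} r^{1/P_w - 1}) dr ≤ K - 1 - log K`, with
equality on the left when some `P_w = 1` and on the right when `P_w = 1/K` on `S`. -/
theorem gumbel_kl_bounds {W : Type*} [Fintype W] (P : W → ℝ)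
    (hnn : ∀ w, 0 ≤ P w) (hsum : ∑ w, P w = 1)
    (K : ℕ) (hK : K = Set.ncard {w | 0 < P w}) (hK1 : 1 ≤ K) :
    (0 ≤ -∫ r in (0:ℝ)..1, Real.log (∑ w, if 0 < P w then r ^ (1 / P w - 1) else 0))
    ∧ (-∫ r in (0:ℝ)..1, Real.log (∑ w, if 0 < P w then r ^ (1 / P w - 1) else 0)
        ≤ (K : ℝ) - 1 - Real.log K)
    ∧ ((∃ w, P w = 1) →
        -∫ r in (0:ℝ)..1, Real.log (∑ w, if 0 < P w then r ^ (1 / P w - 1) else 0) = 0)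
    ∧ ((∀ w, 0 < P w → P w = 1 / (K : ℝ)) →
        -∫ r in (0:ℝ)..1, Real.log (∑ w, if 0 < P w then r ^ (1 / P w - 1) else 0)
          = (K : ℝ) - 1 - Real.log K) := by
  classical
  set S : Finset W := Finset.univ.filter fun w => 0 < P w with hSdef
  have hdens : ∀ r : ℝ, (∑ w, if 0 < P w then r ^ (1 / P w - 1) else 0)
      = GumbelKL.density S P r := fun r => by
    rw [GumbelKL.density, hSdef, Finset.sum_filter]
  have hpos : ∀ w ∈ S, 0 < P w := fun w hw => (Finset.mem_filter.1 hw).2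
  have hsumS : ∑ w ∈ S, P w = 1 := by
    rw [← hsum]
    refine Finset.sum_subset (Finset.subset_univ S) fun w _ hw => ?_
    exact le_antisymm (not_lt.1 fun h => hw (by simp [hSdef, h])) (hnn w)
  have hcard : K = S.card := by
    rw [hK, ← Set.ncard_coe_finset]
    simp [hSdef]
  simp only [hdens]
  have hlow := GumbelKL.neg_integral_log_density_nonneg hpos hsumS
  have hup := GumbelKL.neg_integral_log_density_le hpos hsumS
  rw [hcard]
  refine ⟨hlow, hup, ?_, fun hunif => GumbelKL.neg_integral_log_density_eq
    (GumbelKL.nonempty_of_sum_eq_one hsumS) fun w hw => hunif w (hpos w hw)⟩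
  rintro ⟨a, ha⟩
  have haS : a ∈ S := by simp [hSdef, ha]
  have hS1 : S = {a} := by
    refine Finset.eq_singleton_iff_unique_mem.2 ⟨haS, fun w hw => ?_⟩
    by_contra hne
    have h := Finset.add_le_sum (fun i hi => (hpos i hi).le) haS hw (Ne.symm hne)
    linarith [hpos w hw]
  rw [hS1] at hlow hup ⊢
  simp only [Finset.card_singleton, Nat.cast_one, Real.log_one, sub_self] at hup
  exact le_antisymm hup hlow
end

section
/- Let ξ be a Uniform(0,1) random variable, let P_0 ∈ [0,1], set w = 1 if ξ > P_0 and w = 0 otherwise, and define Y = (2w − 1)(2ξ − 1). Let p = min{P_0, 1 − P_0}. Then the cumulative distribution function of Y is: P(Y ≤ y) = 0 for y ≤ 2p − 1; P(Y ≤ y) = (y+1)/2 − p for 2p − 1 < y ≤ 1 − 2p; P(Y ≤ y) = y for 1 − 2p < y ≤ 1; and P(Y ≤ y) = 1 for y > 1. Equivalently, for y ∈ [−1, 1], P(Y ≤ y) = max(0, (y+1)/2 − P_0) + max(0, (y−1)/2 + P_0). -/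
open MeasureTheory
open scoped ENNReal

/-- The law of the statistic for arbitrary real thresholds: the two summands are the contributions
of the events `w = 1` and `w = 0`. -/
lemma unifMeasure_statistic_le {P0 : ℝ} (hP0 : P0 ∈ Set.Icc (0:ℝ) 1) {Y : ℝ → ℝ}
    (hY : ∀ x : ℝ, Y x = (2 * (if P0 < x then (1:ℝ) else 0) - 1) * (2 * x - 1)) (y : ℝ) :
    unifMeasure {x | Y x ≤ y} = ENNReal.ofReal
      (max 0 (min 1 ((y + 1) / 2) - P0) + max 0 (P0 - max 0 ((1 - y) / 2))) := by
  obtain ⟨h0, h1⟩ := hP0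
  have hae : ({x | Y x ≤ y} ∩ Set.Ioo 0 1 : Set ℝ) =ᵐ[volume]
      (Set.Ioc P0 (min 1 ((y + 1) / 2)) ∪ Set.Ioc (max 0 ((1 - y) / 2)) P0 : Set ℝ) := by
    filter_upwards [Measure.ae_ne volume (1 : ℝ), Measure.ae_ne volume ((1 - y) / 2)]
      with x hx1 hxy
    apply propext
    change (Y x ≤ y ∧ 0 < x ∧ x < 1) ↔
      (P0 < x ∧ x ≤ min 1 ((y + 1) / 2)) ∨ (max 0 ((1 - y) / 2) < x ∧ x ≤ P0)
    rw [hY, le_min_iff, max_lt_iff]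
    split_ifs with h
    · constructor
      · rintro ⟨ha, -, hc⟩
        exact Or.inl ⟨h, hc.le, by linarith⟩
      · rintro (⟨-, hb, hc⟩ | ⟨-, hb⟩)
        · exact ⟨by linarith, by linarith, lt_of_le_of_ne hb hx1⟩
        · linarith
    · rw [not_lt] at h
      constructor
      · rintro ⟨ha, hb, -⟩
        exact Or.inr ⟨⟨hb, lt_of_le_of_ne (by linarith) hxy.symm⟩, h⟩
      · rintro (⟨hb, -⟩ | ⟨⟨hb, hc⟩, -⟩)
        · linarith
        · exact ⟨by linarith, hb, lt_of_le_of_ne (h.trans h1) hx1⟩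
  have hdisj : Disjoint (Set.Ioc P0 (min 1 ((y + 1) / 2)))
      (Set.Ioc (max 0 ((1 - y) / 2)) P0) :=
    Set.disjoint_left.2 fun x hx hx' => hx.1.not_ge hx'.2
  rw [unifMeasure, Measure.restrict_apply' measurableSet_Ioo, measure_congr hae,
    measure_union hdisj measurableSet_Ioc, Real.volume_Ioc, Real.volume_Ioc,
    ENNReal.ofReal_add (le_max_left _ _) (le_max_left _ _)]
  simp [ENNReal.ofReal_max]

/-- CDF of the baby-watermark statistic `Y = (2w-1)(2ξ-1)` where `ξ ~ Uniform(0,1)`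
and `w = 1` iff `ξ > P₀`, with `p = min{P₀, 1-P₀}`. -/
theorem baby_watermark_cdf (P0 : ℝ) (hP0 : P0 ∈ Set.Icc (0:ℝ) 1)
    (Y : ℝ → ℝ)
    (hY : ∀ x : ℝ, Y x = (2 * (if P0 < x then (1:ℝ) else 0) - 1) * (2 * x - 1))
    (p : ℝ) (hp : p = min P0 (1 - P0)) :
    (∀ y : ℝ, y ≤ 2 * p - 1 → unifMeasure {x | Y x ≤ y} = 0)
    ∧ (∀ y : ℝ, 2 * p - 1 < y → y ≤ 1 - 2 * p →
        unifMeasure {x | Y x ≤ y} = ENNReal.ofReal ((y + 1) / 2 - p))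
    ∧ (∀ y : ℝ, 1 - 2 * p < y → y ≤ 1 →
        unifMeasure {x | Y x ≤ y} = ENNReal.ofReal y)
    ∧ (∀ y : ℝ, 1 < y → unifMeasure {x | Y x ≤ y} = 1)
    ∧ (∀ y ∈ Set.Icc (-1:ℝ) 1,
        unifMeasure {x | Y x ≤ y}
          = ENNReal.ofReal (max 0 ((y + 1) / 2 - P0) + max 0 ((y - 1) / 2 + P0))) := by
  have key := unifMeasure_statistic_le hP0 hY
  obtain ⟨h0, h1⟩ := hP0
  refine ⟨fun y hy => ?_, fun y hy hy' => ?_, fun y hy hy' => ?_, fun y hy => ?_,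
    fun y hy => ?_⟩
  · rw [key, ENNReal.ofReal_eq_zero]
    grind
  · rw [key]
    congr 1
    grind
  · rw [key]
    congr 1
    grind
  · rw [key, ENNReal.ofReal_eq_one]
    grind
  · rw [key]
    obtain ⟨hy1, hy2⟩ := hy
    rw [min_eq_right (by linarith), max_eq_right (a := 0) (b := (1 - y) / 2) (by linarith)]
    congr 3
    ring
end

section
/- Adopt the inverse-transform setup. (i) (Null hypothesis) If w is any W-valued random variable independent of the pair (π, U), then for every r ∈ [0,1] and every k ∈ W, P( U ≤ r and π(w) = k ) = r/M. (ii) (Alternative hypothesis) If w = π^{-1}(k(π,U)) is the token produced by the inverse-transform decoder with probability vector P, then for every r ∈ [0,1] and every k ∈ W, P( U ≤ r and π(w) = k ) = (1/M!) · Σ_{π'∈S_M} λ( (a_{π',k−1}, a_{π',k}] ∩ [0,r] ). -/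
open MeasureTheory
open scoped ENNReal

instance permMeasurableSpace (M : ℕ) : MeasurableSpace (Equiv.Perm (Fin M)) := ⊤

/-- The uniform distribution on permutations of `Fin M`. -/
noncomputable def permUnif (M : ℕ) : Measure (Equiv.Perm (Fin M)) :=
  (PMF.uniformOfFintype (Equiv.Perm (Fin M))).toMeasure

/-- Partial sums `a_{σ,i} = Σ_{j<i} P_{σ(j)}` (0-based indexing). -/
def cumsum {M : ℕ} (P : Fin M → ℝ) (σ : Equiv.Perm (Fin M)) (i : ℕ) : ℝ :=
  ∑ j : Fin M, if (j : ℕ) < i then P (σ j) else 0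

theorem unifMeasure_eq_restrict_Ioc : unifMeasure = volume.restrict (Set.Ioc 0 1) :=
  Measure.restrict_congr_set Ioo_ae_eq_Ioc

instance (M : ℕ) : IsProbabilityMeasure (permUnif M) := by
  unfold permUnif; infer_instance

instance (M : ℕ) : DiscreteMeasurableSpace (Equiv.Perm (Fin M)) := ⟨fun _ => trivial⟩

theorem permUnif_singleton (M : ℕ) (σ : Equiv.Perm (Fin M)) :
    permUnif M {σ} = (M.factorial : ℝ≥0∞)⁻¹ := by
  rw [permUnif, PMF.toMeasure_apply_singleton _ _ (measurableSet_singleton σ),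
    PMF.uniformOfFintype_apply, Fintype.card_perm, Fintype.card_fin]

theorem permUnif_prod_apply (M : ℕ) {S : Set (Equiv.Perm (Fin M) × ℝ)} (hS : MeasurableSet S) :
    (permUnif M).prod unifMeasure S =
      (M.factorial : ℝ≥0∞)⁻¹ * ∑ σ, unifMeasure (Prod.mk σ ⁻¹' S) := by
  rw [Measure.prod_apply hS, lintegral_fintype, Finset.mul_sum]
  exact Finset.sum_congr rfl fun σ _ => by rw [permUnif_singleton, mul_comm]

theorem permUnif_apply_eq (M : ℕ) (w k : Fin M) :
    permUnif M {σ | σ w = k} = (M : ℝ≥0∞)⁻¹ := by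
  have hinv (A : Set (Equiv.Perm (Fin M))) (τ : Equiv.Perm (Fin M)) :
      permUnif M ((τ * ·) ⁻¹' A) = permUnif M A := by
    have hsum (B : Set (Equiv.Perm (Fin M))) :
        permUnif M B = ∑ σ, (M.factorial : ℝ≥0∞)⁻¹ * B.indicator 1 σ := by
      rw [← lintegral_indicator_one (Set.toFinite B).measurableSet, lintegral_fintype]
      exact Finset.sum_congr rfl fun σ _ => by rw [permUnif_singleton, mul_comm]
    rw [hsum, hsum A, ← Equiv.sum_comp (Equiv.mulLeft τ) fun σ => _ * A.indicator 1 σ]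
    rfl
  have hconst (j : Fin M) : permUnif M {σ | σ w = j} = permUnif M {σ | σ w = k} := by
    rw [← hinv {σ | σ w = k} (Equiv.swap j k)]
    congr 1
    ext σ
    simp [Equiv.swap_apply_eq_iff]
  have htotal : ∑ j : Fin M, permUnif M {σ | σ w = j} = 1 := by
    have h := sum_measure_preimage_singleton (μ := permUnif M) (f := fun σ => σ w)
      (Finset.univ : Finset (Fin M)) (fun j _ => (Set.toFinite _).measurableSet)
    simpa [Set.preimage] using h
  simp only [hconst, Finset.sum_const, Finset.card_univ, Fintype.card_fin, nsmul_eq_mul] at htotal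
  exact ENNReal.eq_inv_of_mul_eq_one_left (by rwa [mul_comm])

theorem unifMeasure_Iic_s16 {r : ℝ} (hr : r ∈ Set.Icc (0 : ℝ) 1) :
    unifMeasure (Set.Iic r) = ENNReal.ofReal r := by
  rw [unifMeasure_eq_restrict_Ioc, Measure.restrict_apply measurableSet_Iic, Set.inter_comm,
    Set.Ioc_inter_Iic, min_eq_right hr.2, Real.volume_Ioc, sub_zero]

section CumulativeSums

variable {M : ℕ} {P : Fin M → ℝ} (σ : Equiv.Perm (Fin M))

theorem cumsum_mono (hnn : ∀ w, 0 ≤ P w) : Monotone (cumsum P σ) := fun i j hij =>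
  Finset.sum_le_sum fun l _ => by
    split_ifs
    · exact le_rfl
    · omega
    · exact hnn _
    · exact le_rfl

theorem cumsum_zero : cumsum P σ 0 = 0 := by simp [cumsum]

theorem cumsum_nonneg (hnn : ∀ w, 0 ≤ P w) (i : ℕ) : 0 ≤ cumsum P σ i :=
  (cumsum_zero (P := P) σ).symm.trans_le (cumsum_mono σ hnn i.zero_le)

theorem eq_iff_of_isLeast_cumsum (hnn : ∀ w, 0 ≤ P w) {u : ℝ} (hu : 0 < u) {i : Fin M}
    (hi : IsLeast {i : Fin M | u ≤ cumsum P σ ((i : ℕ) + 1)} i) (k : Fin M) :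
    i = k ↔ u ∈ Set.Ioc (cumsum P σ k) (cumsum P σ (k + 1)) := by
  constructor
  · rintro rfl
    refine ⟨?_, hi.1⟩
    by_contra! h
    obtain h0 | h0 := Nat.eq_zero_or_pos (i : ℕ)
    · rw [h0, cumsum_zero] at h
      exact hu.not_ge h
    · have hlt := i.isLt
      have hle : i ≤ ⟨(i : ℕ) - 1, by omega⟩ := hi.2 (by
        have : (i : ℕ) - 1 + 1 = i := by omega
        simpa [this] using h)
      have := Fin.le_def.1 hle
      simp only at this
      omega
  · rintro ⟨h1, h2⟩
    refine le_antisymm (hi.2 h2) ?_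
    by_contra! h
    exact (hi.1.trans (cumsum_mono σ hnn (Nat.succ_le_of_lt h))).not_gt h1

end CumulativeSums

/-- Joint law of `(U, π(w))` for the inverse-transform watermark: (i) under the
null hypothesis (token independent of `(π,U)`), and (ii) under the alternative
(token produced by the inverse-transform decoder `w = π⁻¹(k(π,U))`). -/
theorem inverse_transform_joint_law
    (M : ℕ) (hM : 2 ≤ M) (P : Fin M → ℝ)
    (hnn : ∀ w, 0 ≤ P w) (hsum : ∑ w, P w = 1)
    (kfun : Equiv.Perm (Fin M) → ℝ → Fin M)
    (hk : ∀ (σ : Equiv.Perm (Fin M)) (u : ℝ), 0 < u → u ≤ 1 →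
      IsLeast {i : Fin M | u ≤ cumsum P σ⁻¹ ((i : ℕ) + 1)} (kfun σ u)) :
    (∀ (Ω : Type) [MeasurableSpace Ω] (μ : Measure Ω) [IsProbabilityMeasure μ]
        (wf : Ω → Fin M) (g : Ω → Equiv.Perm (Fin M) × ℝ),
      Measurable wf → Measurable g →
      μ.map g = (permUnif M).prod unifMeasure →
      ProbabilityTheory.IndepFun wf g μ →
      ∀ r ∈ Set.Icc (0:ℝ) 1, ∀ k : Fin M,
        μ {ω | (g ω).2 ≤ r ∧ (g ω).1 (wf ω) = k} = ENNReal.ofReal (r / M))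
    ∧ (∀ r ∈ Set.Icc (0:ℝ) 1, ∀ k : Fin M,
        ((permUnif M).prod unifMeasure)
            {q : Equiv.Perm (Fin M) × ℝ | q.2 ≤ r ∧ q.1 (q.1⁻¹ (kfun q.1 q.2)) = k}
          = ((M.factorial : ℝ≥0∞))⁻¹ *
              ∑ σ : Equiv.Perm (Fin M),
                volume (Set.Ioc (cumsum P σ (k : ℕ)) (cumsum P σ ((k : ℕ) + 1))
                  ∩ Set.Icc 0 r)) := by
  constructor
  · intro Ω _ μ _ wf g hwf hg hmap hind r hr k
    set S : Fin M → Set (Equiv.Perm (Fin M) × ℝ) := fun w => {σ | σ w = k} ×ˢ Set.Iic r with hS_def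
    have hS (w : Fin M) : MeasurableSet (S w) :=
      (Set.toFinite _).measurableSet.prod measurableSet_Iic
    have hE : {ω | (g ω).2 ≤ r ∧ (g ω).1 (wf ω) = k} = ⋃ w, wf ⁻¹' {w} ∩ g ⁻¹' S w := by
      ext ω
      simp [hS_def, and_comm]
    have hterm (w : Fin M) : μ (wf ⁻¹' {w} ∩ g ⁻¹' S w) =
        μ (wf ⁻¹' {w}) * ENNReal.ofReal (r / M) := by
      rw [hind.measure_inter_preimage_eq_mul _ _ (measurableSet_singleton w) (hS w),
        ← Measure.map_apply hg (hS w), hmap, Measure.prod_prod, permUnif_apply_eq,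
        unifMeasure_Iic_s16 hr, ENNReal.ofReal_div_of_pos (by positivity), ENNReal.ofReal_natCast,
        ENNReal.div_eq_inv_mul]
    rw [hE, measure_iUnion _ fun w => (hwf (measurableSet_singleton w)).inter (hg (hS w)),
      tsum_fintype, Finset.sum_congr rfl fun w _ => hterm w, ← Finset.sum_mul,
      sum_measure_preimage_singleton _ fun w _ => hwf (measurableSet_singleton w)]
    · simp
    · intro a b hab
      refine Disjoint.mono Set.inter_subset_left Set.inter_subset_left ?_
      exact Disjoint.preimage _ (Set.disjoint_singleton.2 hab)
  · intro r hr k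
    set T : Set (Equiv.Perm (Fin M) × ℝ) :=
      {q | q.2 ≤ r ∧ q.2 ∈ Set.Ioc (cumsum P q.1⁻¹ k) (cumsum P q.1⁻¹ (k + 1))} with hT_def
    have hT : MeasurableSet T := by
      have hc (i : ℕ) : Measurable fun q : Equiv.Perm (Fin M) × ℝ => cumsum P q.1⁻¹ i :=
        (Measurable.of_discrete (f := fun σ : Equiv.Perm (Fin M) => cumsum P σ⁻¹ i)).comp
          measurable_fst
      exact (measurableSet_le measurable_snd measurable_const).inter
        ((measurableSet_lt (hc _) measurable_snd).inter (measurableSet_le measurable_snd (hc _)))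
    have hae : ∀ᵐ q ∂(permUnif M).prod unifMeasure, q.2 ∈ Set.Ioc (0 : ℝ) 1 := by
      refine Measure.quasiMeasurePreserving_snd.ae (p := fun u => u ∈ Set.Ioc (0 : ℝ) 1) ?_
      rw [unifMeasure_eq_restrict_Ioc]
      exact ae_restrict_mem measurableSet_Ioc
    have hcongr : {q : Equiv.Perm (Fin M) × ℝ | q.2 ≤ r ∧ q.1 (q.1⁻¹ (kfun q.1 q.2)) = k}
        =ᵐ[(permUnif M).prod unifMeasure] T := by
      filter_upwards [hae] with q hq
      refine propext (and_congr_right fun _ => ?_)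
      rw [Equiv.Perm.inv_def, Equiv.apply_symm_apply]
      exact eq_iff_of_isLeast_cumsum _ hnn hq.1 (hk q.1 q.2 hq.1 hq.2) k
    rw [measure_congr hcongr, permUnif_prod_apply M hT,
      ← Equiv.sum_comp (Equiv.inv (Equiv.Perm (Fin M)))]
    congr 1
    refine Finset.sum_congr rfl fun σ _ => ?_
    rw [unifMeasure_eq_restrict_Ioc, Measure.restrict_apply (measurable_prodMk_left hT)]
    congr 1
    ext u
    have h0 := cumsum_nonneg σ hnn k
    simp only [hT_def, Set.mem_inter_iff, Set.mem_preimage, Set.mem_ofPred_eq, Equiv.inv_apply,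
      inv_inv, Set.mem_Ioc, Set.mem_Icc]
    constructor
    · rintro ⟨⟨h1, h2⟩, h3, -⟩
      exact ⟨h2, h3.le, h1⟩
    · rintro ⟨h2, -, h1⟩
      exact ⟨⟨h1, h2⟩, h0.trans_lt h2.1, h1.trans hr.2⟩
end

section
/- (i) For every r ∈ [0,1], lim_{M→∞} (1/M) · Σ_{i=1}^{M} [ min{ (i−1)/(M−1) + r, 1 } − max{ (i−1)/(M−1) − r, 0 } ] = 1 − (1−r)². (ii) Fix Δ ∈ [0,1). For each M ≥ 2 let P^{(M)} be a probability vector on {1,…,M} whose largest entry P^{(M)}_{(1)} converges to 1−Δ and whose second-largest entry P^{(M)}_{(2)} satisfies (log M) · P^{(M)}_{(2)} → 0 as M → ∞, and let Y^dif_M = |U − η(k(π,U))| be the detection statistic of the inverse-transform decoder with probability vector P^{(M)}. Then for every r ∈ [0, 1−Δ], lim_{M→∞} P( Y^dif_M ≤ r ) = 1 − (1 − r/(1−Δ))². -/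
open MeasureTheory Filter
open scoped ENNReal

/-- The normalization `η(i) = (i-1)/(M-1)` (with 0-based indexing, `i/(M-1)`). -/
noncomputable def eta (M : ℕ) (i : Fin M) : ℝ := (i : ℕ) / ((M : ℝ) - 1)

/-- The length of `{x ∈ [0,1] : |x - v| ≤ s}` for `v ∈ [0,1]`. -/
noncomputable def windowLength (s v : ℝ) : ℝ := min v s + min (1 - v) s

lemma windowLength_nonneg {s v : ℝ} (hs : 0 ≤ s) (hv0 : 0 ≤ v) (hv1 : v ≤ 1) :
    0 ≤ windowLength s v :=
  add_nonneg (le_min hv0 hs) (le_min (by linarith) hs)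

lemma windowLength_le_one (s v : ℝ) : windowLength s v ≤ 1 := by
  unfold windowLength
  linarith [min_le_left v s, min_le_left (1 - v) s]

lemma windowLength_eq (s v : ℝ) :
    windowLength s v = min (v + s) 1 - max (v - s) 0 := by
  unfold windowLength
  grind

lemma abs_windowLength_sub_le (s t v : ℝ) :
    |windowLength s v - windowLength t v| ≤ 2 * |s - t| := by
  have h (x : ℝ) : |min x s - min x t| ≤ |s - t| := by
    simpa using abs_min_sub_min_le_max x s x t
  have := abs_add_le (min v s - min v t) (min (1 - v) s - min (1 - v) t)
  unfold windowLength
  calc _ = |min v s - min v t + (min (1 - v) s - min (1 - v) t)| := by ring_nf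
    _ ≤ _ := by linarith [h v, h (1 - v)]

/-- The antiderivative of `x ↦ min x r` vanishing at `0`, for `0 ≤ r`. -/
noncomputable def minPrimitive (r x : ℝ) : ℝ := x ^ 2 / 2 - (max (x - r) 0) ^ 2 / 2

lemma abs_minPrimitive_add_sub_le (r x h : ℝ) :
    |minPrimitive r (x + h) - minPrimitive r x - h * min x r| ≤ h ^ 2 := by
  unfold minPrimitive
  rw [abs_le]
  rcases le_total x r with h1 | h1 <;> rcases le_total (x + h) r with h2 | h2
  · rw [max_eq_right (by linarith), max_eq_right (by linarith), min_eq_left h1]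
    constructor <;> nlinarith [sq_nonneg h]
  · rw [max_eq_left (by linarith), max_eq_right (by linarith), min_eq_left h1]
    constructor <;> nlinarith [sq_nonneg h, mul_nonneg (sub_nonneg.2 h1) (sub_nonneg.2 h2)]
  · rw [max_eq_right (by linarith), max_eq_left (by linarith), min_eq_right h1]
    constructor <;> nlinarith [sq_nonneg h, mul_nonneg (sub_nonneg.2 h1) (sub_nonneg.2 h2)]
  · rw [max_eq_left (by linarith), max_eq_left (by linarith), min_eq_right h1]
    constructor <;> nlinarith [sq_nonneg h]

lemma abs_sum_windowLength_sub_le (r h : ℝ) (M : ℕ) :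
    |minPrimitive r (M * h) - minPrimitive r (1 - M * h) - (minPrimitive r 0 - minPrimitive r 1)
      - h * ∑ i ∈ Finset.range M, windowLength r (i * h)| ≤ 2 * M * h ^ 2 := by
  induction M with
  | zero => simp
  | succ n ih =>
    rw [Finset.sum_range_succ]
    have h1 := abs_minPrimitive_add_sub_le r (n * h) h
    have h2 := abs_minPrimitive_add_sub_le r (1 - n * h) (-h)
    have e1 : ((n + 1 : ℕ) : ℝ) * h = n * h + h := by push_cast; ring
    have e2 : 1 - (n * h + h) = 1 - n * h + -h := by ring
    rw [e1, e2]
    push_cast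
    rw [abs_le] at *
    unfold windowLength at *
    constructor <;> linarith [h1.1, h1.2, h2.1, h2.2, ih.1, ih.2]

lemma tendsto_grid_average_windowLength {r : ℝ} (hr : r ∈ Set.Icc (0 : ℝ) 1) :
    Tendsto (fun M : ℕ => (1 / (M : ℝ)) *
      ∑ i : Fin M, windowLength r ((i : ℕ) / ((M : ℝ) - 1))) atTop
      (nhds (1 - (1 - r) ^ 2)) := by
  have hM : Tendsto (fun M : ℕ => (M : ℝ)) atTop atTop := tendsto_natCast_atTop_atTop
  have hM1 : Tendsto (fun M : ℕ => (M : ℝ) - 1) atTop atTop :=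
    tendsto_atTop_add_const_right _ (-1) hM
  have hh : Tendsto (fun M : ℕ => ((M : ℝ) - 1)⁻¹) atTop (nhds 0) := hM1.inv_tendsto_atTop
  have hMi : Tendsto (fun M : ℕ => (M : ℝ)⁻¹) atTop (nhds 0) := hM.inv_tendsto_atTop
  have hMh : Tendsto (fun M : ℕ => (M : ℝ) * ((M : ℝ) - 1)⁻¹) atTop (nhds 1) := by
    have : Tendsto (fun M : ℕ => 1 + ((M : ℝ) - 1)⁻¹) atTop (nhds (1 + 0)) := hh.const_add 1
    rw [add_zero] at this
    refine this.congr' ?_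
    filter_upwards [eventually_ge_atTop 2] with M hM2
    have : (2 : ℝ) ≤ M := by exact_mod_cast hM2
    have : (M : ℝ) - 1 ≠ 0 := by linarith
    field_simp
    ring
  have hG : Continuous (minPrimitive r) := by unfold minPrimitive; fun_prop
  have hmain : Tendsto (fun M : ℕ => minPrimitive r (M * ((M : ℝ) - 1)⁻¹)
      - minPrimitive r (1 - M * ((M : ℝ) - 1)⁻¹) - (minPrimitive r 0 - minPrimitive r 1)) atTop
      (nhds (1 - (1 - r) ^ 2)) := by
    have h1 := (hG.tendsto _).comp hMh
    have h2 := (hG.tendsto _).comp (hMh.const_sub 1)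
    have h3 := (h1.sub h2).sub_const (minPrimitive r 0 - minPrimitive r 1)
    have hval : 1 - (1 - r) ^ 2 = minPrimitive r 1 - minPrimitive r (1 - 1)
        - (minPrimitive r 0 - minPrimitive r 1) := by
      unfold minPrimitive
      rw [sub_self, max_eq_left (by linarith [hr.2]), max_eq_right (by linarith [hr.1])]
      ring
    rw [hval]
    exact h3
  have herr : Tendsto (fun M : ℕ => 2 * (M : ℝ) * (((M : ℝ) - 1)⁻¹) ^ 2) atTop (nhds 0) := by
    have := (hMh.mul hh).const_mul 2
    rw [mul_zero, mul_zero] at this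
    exact this.congr fun M => by ring
  have hsum : Tendsto (fun M : ℕ => ((M : ℝ) - 1)⁻¹ *
      ∑ i ∈ Finset.range M, windowLength r (i * ((M : ℝ) - 1)⁻¹)) atTop
      (nhds (1 - (1 - r) ^ 2)) := by
    have := hmain.sub (squeeze_zero_norm (fun M => abs_sum_windowLength_sub_le r
      (((M : ℝ) - 1)⁻¹) M) herr)
    rw [sub_zero] at this
    exact this.congr fun M => by ring
  have := (hMi.const_sub 1).mul hsum
  rw [sub_zero, one_mul] at this
  refine this.congr' ?_
  filter_upwards [eventually_ge_atTop 2] with M hM2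
  have : (2 : ℝ) ≤ M := by exact_mod_cast hM2
  have h1 : (M : ℝ) - 1 ≠ 0 := by linarith
  rw [Fin.sum_univ_eq_sum_range (fun i => windowLength r ((i : ℕ) / ((M : ℝ) - 1))) M]
  simp only [div_eq_mul_inv]
  field_simp

section PermSums

variable {α : Type*} [Fintype α] [DecidableEq α]

lemma card_mul_sum_perm_apply (f : α → ℝ) (w : α) :
    (Fintype.card α : ℝ) * ∑ σ : Equiv.Perm α, f (σ w)
      = (Fintype.card α).factorial * ∑ i, f i := by
  have h (w' : α) : ∑ σ : Equiv.Perm α, f (σ w') = ∑ σ : Equiv.Perm α, f (σ w) := by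
    rw [← Equiv.sum_comp (Equiv.mulRight (Equiv.swap w w')) fun σ : Equiv.Perm α => f (σ w')]
    simp
  calc _ = ∑ w' : α, ∑ σ : Equiv.Perm α, f (σ w') := by simp [h]
    _ = ∑ σ : Equiv.Perm α, ∑ i, f i := by
      rw [Finset.sum_comm]
      exact Finset.sum_congr rfl fun σ _ => Equiv.sum_comp σ f
    _ = _ := by simp [Fintype.card_perm]

lemma sum_perm_mul_nonpos {D : α → ℝ} (hD : ∑ i, D i = 0) {i j : α} (hij : i ≠ j) :
    ∑ σ : Equiv.Perm α, D (σ i) * D (σ j) ≤ 0 := by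
  have h (j' : α) (hj' : j' ∈ Finset.univ.erase i) :
      ∑ σ : Equiv.Perm α, D (σ i) * D (σ j') = ∑ σ : Equiv.Perm α, D (σ i) * D (σ j) := by
    rw [← Equiv.sum_comp (Equiv.mulRight (Equiv.swap j j'))
      fun σ : Equiv.Perm α => D (σ i) * D (σ j')]
    simp [Equiv.swap_apply_of_ne_of_ne hij (Finset.ne_of_mem_erase hj').symm]
  have htot : ∑ j', ∑ σ : Equiv.Perm α, D (σ i) * D (σ j') = 0 := by
    rw [Finset.sum_comm]
    refine Finset.sum_eq_zero fun σ _ => ?_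
    rw [← Finset.mul_sum, Equiv.sum_comp σ D, hD, mul_zero]
  rw [← Finset.add_sum_erase _ _ (Finset.mem_univ i), Finset.sum_congr rfl h,
    Finset.sum_const, nsmul_eq_mul] at htot
  have hpos : (0 : ℝ) < (Finset.univ.erase i).card := by
    exact_mod_cast Finset.card_pos.2 ⟨j, by simp [hij.symm]⟩
  have hsq : 0 ≤ ∑ σ : Equiv.Perm α, D (σ i) * D (σ i) :=
    Finset.sum_nonneg fun σ _ => mul_self_nonneg _
  by_contra! hc
  nlinarith [mul_pos hpos hc]

lemma sum_perm_sq_sum_le {D : α → ℝ} (hD : ∑ i, D i = 0) (s : Finset α) :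
    ∑ σ : Equiv.Perm α, (∑ j ∈ s, D (σ j)) ^ 2
      ≤ (Fintype.card α).factorial * ∑ i, D i ^ 2 := by
  have h1 : ∑ σ : Equiv.Perm α, (∑ j ∈ s, D (σ j)) ^ 2
      ≤ ∑ j ∈ s, ∑ σ : Equiv.Perm α, D (σ j) ^ 2 := by
    simp only [pow_two, Finset.sum_mul_sum]
    rw [Finset.sum_comm]
    refine Finset.sum_le_sum fun i hi => ?_
    rw [Finset.sum_comm, ← Finset.add_sum_erase _ _ hi]
    have := Finset.sum_nonpos fun j (hj : j ∈ s.erase i) =>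
      sum_perm_mul_nonpos hD (Finset.ne_of_mem_erase hj).symm
    linarith
  refine h1.trans ?_
  calc _ ≤ ∑ j, ∑ σ : Equiv.Perm α, D (σ j) ^ 2 :=
        Finset.sum_le_sum_of_subset_of_nonneg (Finset.subset_univ s)
          fun _ _ _ => Finset.sum_nonneg fun _ _ => sq_nonneg _
    _ = ∑ σ : Equiv.Perm α, ∑ i, D i ^ 2 := by
      rw [Finset.sum_comm]
      exact Finset.sum_congr rfl fun σ _ => Equiv.sum_comp σ fun i => D i ^ 2
    _ = _ := by simp [Fintype.card_perm]

end PermSums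

lemma permUnif_prod_le {M : ℕ} {T : Set (Equiv.Perm (Fin M) × ℝ)} {B : Equiv.Perm (Fin M) → ℝ}
    (hB : ∀ σ, 0 ≤ B σ) (hT : ∀ σ, unifMeasure {u | (σ, u) ∈ T} ≤ ENNReal.ofReal (B σ)) :
    ((permUnif M).prod unifMeasure) T ≤ ENNReal.ofReal ((∑ σ, B σ) / M.factorial) := by
  have hsing (σ : Equiv.Perm (Fin M)) : permUnif M {σ} = ENNReal.ofReal (M.factorial : ℝ)⁻¹ := by
    rw [permUnif, PMF.toMeasure_apply_singleton _ _ (by trivial),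
      PMF.uniformOfFintype_apply, Fintype.card_perm, Fintype.card_fin,
      ENNReal.ofReal_inv_of_pos (by positivity), ENNReal.ofReal_natCast]
  have : SFinite unifMeasure := by unfold unifMeasure; infer_instance
  have : SFinite (permUnif M) := by unfold permUnif; infer_instance
  have hsub : T ⊆ ⋃ σ : Equiv.Perm (Fin M), {σ} ×ˢ {u | (σ, u) ∈ T} := by
    rintro ⟨σ, u⟩ h
    simpa using h
  calc _ ≤ _ := measure_mono hsub
    _ ≤ ∑ σ, ((permUnif M).prod unifMeasure) ({σ} ×ˢ {u | (σ, u) ∈ T}) :=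
      measure_iUnion_fintype_le _ _
    _ ≤ ∑ σ, ENNReal.ofReal (B σ / M.factorial) := by
      refine Finset.sum_le_sum fun σ _ => ?_
      rw [Measure.prod_prod, hsing, div_eq_inv_mul, ENNReal.ofReal_mul (by positivity)]
      gcongr
      exact hT σ
    _ = _ := by
      rw [← ENNReal.ofReal_sum_of_nonneg fun σ _ => div_nonneg (hB σ) (by positivity),
        Finset.sum_div]

/-- Location of a point `u` selecting the normalized index `x`, when the heavy atom has normalized
index `v` and mass `p` and the remaining mass `q` is spread evenly up to an error `e`: before, inside
or after the atom. -/
def AtomRegions (p q v e x u : ℝ) : Prop :=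
  (|u - q * x| ≤ e ∧ u ≤ q * v + e) ∨
  (x = v ∧ q * v - e ≤ u ∧ u ≤ q * v + p + e) ∨
  (|u - p - q * x| ≤ e ∧ p + q * v - e ≤ u)

lemma atomRegions_of_cumulative {M : ℕ} (hM : 2 ≤ M) {R : ℕ → ℝ} (hmono : Monotone R)
    {p q ε : ℝ} (hq0 : 0 ≤ q) (hq1 : q ≤ 1)
    (hR : ∀ i ≤ M, |R i - q * ((i : ℝ) / M)| ≤ ε) (N k : Fin M) {u : ℝ}
    (h1 : R k + (if (N : ℕ) < k then p else 0) < u)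
    (h2 : u ≤ R (k + 1) + (if (N : ℕ) < k + 1 then p else 0)) :
    AtomRegions p q (eta M N) (ε + 1 / M) (eta M k) u := by
  have hM' : (2 : ℝ) ≤ M := by exact_mod_cast hM
  have grid (i : Fin M) : (i : ℝ) / M ≤ eta M i ∧ eta M i ≤ ((i + 1 : ℕ) : ℝ) / M ∧
      ((i + 1 : ℕ) : ℝ) / M = (i : ℝ) / M + 1 / M := by
    have hi : ((i : ℕ) : ℝ) + 1 ≤ M := by exact_mod_cast i.isLt
    have hi0 : (0 : ℝ) ≤ (i : ℕ) := by positivity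
    unfold eta
    refine ⟨?_, ?_, ?_⟩
    · apply div_le_div_of_nonneg_left hi0 <;> linarith
    · rw [div_le_div_iff₀ (by linarith) (by linarith)]
      push_cast
      nlinarith
    · push_cast
      ring
  have bound (i : Fin M) : |R i - q * eta M i| ≤ ε + 1 / M ∧
      |R (i + 1) - q * eta M i| ≤ ε + 1 / M := by
    obtain ⟨g1, g2, g3⟩ := grid i
    have r1 := abs_le.1 (hR i i.isLt.le)
    have r2 := abs_le.1 (hR (i + 1) i.isLt)
    have m1 := mul_le_mul_of_nonneg_left g1 hq0
    have m2 := mul_le_mul_of_nonneg_left g2 hq0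
    have m3 : q * (1 / M : ℝ) ≤ 1 * (1 / M) := by gcongr
    rw [g3] at r2 m2
    rw [mul_add] at r2 m2
    constructor <;> rw [abs_le] <;> constructor <;> linarith
  have bk := bound k
  have bN := bound N
  simp only [abs_le] at bk bN
  unfold AtomRegions
  rcases lt_trichotomy (k : ℕ) N with h | h | h
  · left
    rw [if_neg (by omega)] at h1 h2
    have := hmono (show (k : ℕ) + 1 ≤ N by omega)
    rw [abs_le]
    exact ⟨⟨by linarith, by linarith⟩, by linarith⟩
  · right; left
    obtain rfl : k = N := Fin.ext h
    rw [if_neg (by omega)] at h1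
    rw [if_pos (by omega)] at h2
    exact ⟨rfl, by linarith, by linarith⟩
  · right; right
    rw [if_pos (by omega)] at h1 h2
    have := hmono (show (N : ℕ) + 1 ≤ k by omega)
    rw [abs_le]
    exact ⟨⟨by linarith, by linarith⟩, by linarith⟩

lemma mem_of_abs_sub_le {p q v s d x u : ℝ} (hp : 0 < p) (hq : 0 ≤ q) (hpq : p + q = 1)
    (hd : 0 ≤ d) (hu0 : 0 < u) (hu1 : u < 1)
    (h : AtomRegions p q v (p * d) x u) (hx : |u - x| ≤ p * s) :
    u ∈ Set.Icc 0 (q * min v s + 2 * d) ∪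
      (Set.Icc (max (q * v - p * d) (v - p * s)) (min (q * v + p + p * d) (v + p * s)) ∪
        Set.Icc (1 - q * min (1 - v) s - 2 * d) 1) := by
  have hpd : p * d ≤ d := by nlinarith
  have hqd : q * d ≤ d := by nlinarith
  obtain rfl : q = 1 - p := by linarith
  rw [abs_le] at hx
  rcases h with ⟨h1, h2⟩ | ⟨rfl, h1, h2⟩ | ⟨h1, h2⟩
  · left
    rw [abs_le] at h1
    refine ⟨hu0.le, ?_⟩
    have hxs : x ≤ s + d := le_of_mul_le_mul_left (by linarith) hp
    rcases min_cases v s with ⟨e, _⟩ | ⟨e, _⟩ <;> rw [e]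
    · linarith
    · nlinarith [mul_le_mul_of_nonneg_left hxs hq]
  · right; left
    exact ⟨max_le h1 (by linarith), le_min h2 (by linarith)⟩
  · right; right
    rw [abs_le] at h1
    refine ⟨?_, hu1.le⟩
    have hxs : 1 - x ≤ s + d := le_of_mul_le_mul_left (by linarith) hp
    rcases min_cases (1 - v) s with ⟨e, _⟩ | ⟨e, _⟩ <;> rw [e]
    · linarith
    · nlinarith [mul_le_mul_of_nonneg_left hxs hq]

lemma mem_of_lt_abs_sub {p q v s d x u : ℝ} (hp : 0 < p) (hq : 0 ≤ q) (hpq : p + q = 1)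
    (hs : 0 ≤ s) (hd : 0 ≤ d) (hx0 : 0 ≤ x) (hx1 : x ≤ 1) (hu0 : 0 < u) (hu1 : u < 1)
    (h : AtomRegions p q v (p * d) x u) (hx : p * s < |u - x|) :
    u ∈ Set.Icc (q * min v s - 2 * d) (q * v + p * d) ∪
      (Set.Icc (q * v - p * d) (v - p * s) ∪
        (Set.Icc (v + p * s) (q * v + p + p * d) ∪
          Set.Icc (p + q * v - p * d) (1 - q * min (1 - v) s + 2 * d))) := by
  have hpd : p * d ≤ d := by nlinarith
  have hqd : q * d ≤ d := by nlinarith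
  have hm1 := mul_le_mul_of_nonneg_left (min_le_right v s) hq
  have hm2 := mul_le_mul_of_nonneg_left (min_le_right (1 - v) s) hq
  have hq1 : q ≤ 1 := by linarith
  obtain rfl : q = 1 - p := by linarith
  rw [lt_abs] at hx
  rcases h with ⟨h1, h2⟩ | ⟨rfl, h1, h2⟩ | ⟨h1, h2⟩
  · left
    rw [abs_le] at h1
    refine ⟨?_, h2⟩
    rcases hx with hx | hx
    · have : s ≤ d := le_of_mul_le_mul_left (by nlinarith) hp
      nlinarith
    · have hxs : s - d ≤ x := le_of_mul_le_mul_left (by linarith) hp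
      nlinarith [mul_le_mul_of_nonneg_left hxs hq]
  · right
    rcases hx with hx | hx
    · right; left
      exact ⟨by linarith, h2⟩
    · left
      exact ⟨h1, by linarith⟩
  · right; right; right
    rw [abs_le] at h1
    refine ⟨h2, ?_⟩
    rcases hx with hx | hx
    · have hxs : s - d ≤ 1 - x := le_of_mul_le_mul_left (by linarith) hp
      nlinarith [mul_le_mul_of_nonneg_left hxs hq]
    · have : s ≤ d := le_of_mul_le_mul_left (by nlinarith) hp
      nlinarith

lemma unifMeasure_apply (S : Set ℝ) : unifMeasure S = volume (S ∩ Set.Ioo 0 1) :=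
  Measure.restrict_apply' measurableSet_Ioo

lemma unifMeasure_abs_sub_le_le {p q v s d : ℝ} (hp : 0 < p) (hq : 0 ≤ q) (hpq : p + q = 1)
    (hs : 0 ≤ s) (hd : 0 ≤ d) (hv0 : 0 ≤ v) (hv1 : v ≤ 1) {x : ℝ → ℝ}
    (h : ∀ u, 0 < u → u < 1 → AtomRegions p q v (p * d) (x u) u) :
    unifMeasure {u | |u - x u| ≤ p * s} ≤ ENNReal.ofReal (windowLength s v + 10 * d) := by
  have hsub : {u | |u - x u| ≤ p * s} ∩ Set.Ioo 0 1 ⊆ _ := fun u hu =>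
    mem_of_abs_sub_le hp hq hpq hd hu.2.1 hu.2.2 (h u hu.2.1 hu.2.2) hu.1
  have hpd : p * d ≤ d := by nlinarith
  have hm1 : 0 ≤ min v s := le_min hv0 hs
  have hm2 : 0 ≤ min (1 - v) s := le_min (by linarith) hs
  have hq1 := mul_nonneg hq hm1
  have hq2 := mul_nonneg hq hm2
  have hmid : min (q * v + p + p * d) (v + p * s) - max (q * v - p * d) (v - p * s)
      ≤ p * min v s + p * min (1 - v) s + 2 * d := by
    have l1 := min_le_left (q * v + p + p * d) (v + p * s)
    have l2 := min_le_right (q * v + p + p * d) (v + p * s)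
    have l3 := le_max_left (q * v - p * d) (v - p * s)
    have l4 := le_max_right (q * v - p * d) (v - p * s)
    obtain rfl : q = 1 - p := by linarith
    rcases min_cases v s with ⟨e1, _⟩ | ⟨e1, _⟩ <;>
      rcases min_cases (1 - v) s with ⟨e2, _⟩ | ⟨e2, _⟩ <;> rw [e1, e2] <;> linarith
  rw [unifMeasure_apply]
  calc _ ≤ _ := measure_mono hsub
    _ ≤ _ := (measure_union_le _ _).trans (add_le_add_right (measure_union_le _ _) _)
    _ ≤ ENNReal.ofReal (q * min v s + 2 * d) +
        (ENNReal.ofReal (p * min v s + p * min (1 - v) s + 2 * d) +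
          ENNReal.ofReal (q * min (1 - v) s + 2 * d)) := by
      simp only [Real.volume_Icc]
      gcongr <;> linarith
    _ ≤ _ := by
      rw [← ENNReal.ofReal_add (by positivity) (by positivity),
        ← ENNReal.ofReal_add (by positivity) (by positivity)]
      apply ENNReal.ofReal_le_ofReal
      obtain rfl : q = 1 - p := by linarith
      unfold windowLength
      linarith

lemma unifMeasure_lt_abs_sub_le {p q v s d : ℝ} (hp : 0 < p) (hq : 0 ≤ q) (hpq : p + q = 1)
    (hs : 0 ≤ s) (hd : 0 ≤ d) {x : ℝ → ℝ} (hx0 : ∀ u, 0 ≤ x u) (hx1 : ∀ u, x u ≤ 1)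
    (h : ∀ u, 0 < u → u < 1 → AtomRegions p q v (p * d) (x u) u) :
    unifMeasure {u | p * s < |u - x u|} ≤ ENNReal.ofReal (1 - windowLength s v + 10 * d) := by
  have hsub : {u | p * s < |u - x u|} ∩ Set.Ioo 0 1 ⊆ _ := fun u hu =>
    mem_of_lt_abs_sub hp hq hpq hs hd (hx0 u) (hx1 u) hu.2.1 hu.2.2 (h u hu.2.1 hu.2.2) hu.1
  have hpd : p * d ≤ d := by nlinarith
  have a1 : 0 ≤ v - min v s := sub_nonneg.2 (min_le_left _ _)
  have a2 : 0 ≤ 1 - v - min (1 - v) s := sub_nonneg.2 (min_le_left _ _)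
  have b1 := mul_le_mul_of_nonneg_left (min_le_right v s) hp.le
  have b2 := mul_le_mul_of_nonneg_left (min_le_right (1 - v) s) hp.le
  have c1 := mul_nonneg hq a1
  have c2 := mul_nonneg hq a2
  have c3 := mul_nonneg hp.le a1
  have c4 := mul_nonneg hp.le a2
  obtain rfl : q = 1 - p := by linarith
  rw [unifMeasure_apply]
  calc _ ≤ _ := measure_mono hsub
    _ ≤ _ := (measure_union_le _ _).trans (add_le_add_right ((measure_union_le _ _).trans
      (add_le_add_right (measure_union_le _ _) _)) _)
    _ ≤ ENNReal.ofReal ((1 - p) * (v - min v s) + 3 * d) +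
        (ENNReal.ofReal (p * (v - min v s) + d) +
          (ENNReal.ofReal (p * (1 - v - min (1 - v) s) + d) +
            ENNReal.ofReal ((1 - p) * (1 - v - min (1 - v) s) + 3 * d))) := by
      simp only [Real.volume_Icc]
      gcongr <;> linarith
    _ ≤ _ := by
      rw [← ENNReal.ofReal_add (by positivity) (by positivity),
        ← ENNReal.ofReal_add (by positivity) (by positivity),
        ← ENNReal.ofReal_add (by positivity) (by positivity)]
      apply ENNReal.ofReal_le_ofReal
      unfold windowLength
      linarith

/-- The weights `P` with the atom `w₀` removed. -/
def dropAtom {M : ℕ} (P : Fin M → ℝ) (w₀ : Fin M) (w : Fin M) : ℝ := if w = w₀ then 0 else P w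

lemma dropAtom_nonneg {M : ℕ} {P : Fin M → ℝ} (hP : ∀ w, 0 ≤ P w) (w₀ w : Fin M) :
    0 ≤ dropAtom P w₀ w := by
  unfold dropAtom
  split_ifs
  exacts [le_rfl, hP w]

lemma add_sum_dropAtom {M : ℕ} (P : Fin M → ℝ) (w₀ : Fin M) :
    P w₀ + ∑ w, dropAtom P w₀ w = ∑ w, P w := by
  have h (w : Fin M) : P w = (if w = w₀ then P w₀ else 0) + dropAtom P w₀ w := by
    unfold dropAtom
    split_ifs with hw
    · simp [hw]
    · simp
  rw [Finset.sum_congr rfl fun w _ => h w, Finset.sum_add_distrib]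
  simp

lemma cumsum_eq_dropAtom {M : ℕ} (P : Fin M → ℝ) (w₀ : Fin M) (σ : Equiv.Perm (Fin M)) (i : ℕ) :
    cumsum P σ⁻¹ i
      = cumsum (dropAtom P w₀) σ⁻¹ i + if ((σ w₀ : Fin M) : ℕ) < i then P w₀ else 0 := by
  have h (j : Fin M) : (if (j : ℕ) < i then P (σ⁻¹ j) else 0)
      = (if (j : ℕ) < i then dropAtom P w₀ (σ⁻¹ j) else 0)
        + if j = σ w₀ then (if ((σ w₀ : Fin M) : ℕ) < i then P w₀ else 0) else 0 := by
    unfold dropAtom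
    by_cases hj : j = σ w₀
    · subst hj
      simp
    · have : σ⁻¹ j ≠ w₀ := fun h => hj (by rw [← h]; simp)
      rw [if_neg this, if_neg hj, add_zero]
  unfold cumsum
  rw [Finset.sum_congr rfl fun j _ => h j, Finset.sum_add_distrib]
  simp

lemma cumsum_mono_s18 {M : ℕ} {Q : Fin M → ℝ} (hQ : ∀ w, 0 ≤ Q w) (σ : Equiv.Perm (Fin M)) :
    Monotone (cumsum Q σ) := by
  intro i j hij
  refine Finset.sum_le_sum fun l _ => ?_
  split_ifs with h1 h2
  · exact le_rfl
  · omega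
  · exact hQ _
  · exact le_rfl

lemma sum_perm_sq_cumsum_sub_le {M : ℕ} (hM : 0 < M) (Q : Fin M → ℝ) {i : ℕ} (hi : i ≤ M) :
    ∑ σ : Equiv.Perm (Fin M), (cumsum Q σ⁻¹ i - (∑ w, Q w) * ((i : ℝ) / M)) ^ 2
      ≤ M.factorial * ∑ w, Q w ^ 2 := by
  have hM' : (M : ℝ) ≠ 0 := by positivity
  set q := ∑ w, Q w with hq
  set s : Finset (Fin M) := Finset.univ.filter fun j => (j : ℕ) < i with hs
  have hcard : s.card = i := by
    rw [hs, Fin.card_filter_val_lt, min_eq_right hi]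
  have hD : ∑ w, (Q w - q / M) = 0 := by
    rw [Finset.sum_sub_distrib, ← hq]
    simp [mul_div_cancel₀ _ hM']
  have hcs (σ : Equiv.Perm (Fin M)) :
      cumsum Q σ i - q * ((i : ℝ) / M) = ∑ j ∈ s, (Q (σ j) - q / M) := by
    rw [Finset.sum_sub_distrib, Finset.sum_const, hcard, hs, Finset.sum_filter, nsmul_eq_mul]
    unfold cumsum
    ring
  have hDsq : ∑ w, (Q w - q / M) ^ 2 ≤ ∑ w, Q w ^ 2 := by
    have : ∑ w, (Q w - q / M) ^ 2 = ∑ w, Q w ^ 2 - q ^ 2 / M := by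
      have h (w : Fin M) : (Q w - q / M) ^ 2 = Q w ^ 2 - 2 * (q / M) * Q w + (q / M) ^ 2 := by ring
      rw [Finset.sum_congr rfl fun w _ => h w, Finset.sum_add_distrib, Finset.sum_sub_distrib,
        ← Finset.mul_sum, ← hq]
      simp
      field_simp
      ring
    rw [this]
    have : 0 ≤ q ^ 2 / M := by positivity
    linarith
  have hinv := Equiv.sum_comp (Equiv.inv (Equiv.Perm (Fin M)))
    fun σ : Equiv.Perm (Fin M) => (cumsum Q σ i - q * ((i : ℝ) / M)) ^ 2
  simp only [Equiv.inv_apply] at hinv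
  rw [hinv, Finset.sum_congr rfl fun σ _ => by rw [hcs σ]]
  have := sum_perm_sq_sum_le hD s
  rw [Fintype.card_fin] at this
  exact this.trans (by gcongr)

lemma abs_sub_le_of_grid {M K : ℕ} (hM : 0 < M) (hK : 0 < K) {R : ℕ → ℝ} (hmono : Monotone R)
    {q δ : ℝ} (hq1 : q ≤ 1)
    (h : ∀ j ≤ K, |R (M * j / K) - q * (((M * j / K : ℕ) : ℝ) / M)| ≤ δ) {i : ℕ} (hi : i ≤ M) :
    |R i - q * ((i : ℝ) / M)| ≤ δ + 1 / K + 1 / M := by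
  have hKr : (0 : ℝ) < K := by exact_mod_cast hK
  have hMr : (0 : ℝ) < M := by exact_mod_cast hM
  have hK0 : 0 < 1 / (K : ℝ) := by positivity
  have hM0 : 0 < 1 / (M : ℝ) := by positivity
  rcases hi.lt_or_eq with hi | rfl
  · set j := i * K / M with hj
    have hjK : j + 1 ≤ K := by
      rw [hj, Nat.succ_le_iff, Nat.div_lt_iff_lt_mul hM, mul_comm K]
      exact Nat.mul_lt_mul_of_pos_right hi hK
    have hlo : M * j / K ≤ i := by
      apply Nat.div_le_of_le_mul
      rw [mul_comm K]
      exact Nat.mul_div_le _ _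
    have hhi : i ≤ M * (j + 1) / K := by
      rw [Nat.le_div_iff_mul_le hK]
      exact (Nat.lt_mul_div_succ _ hM).le
    have hgap : ((M * (j + 1) / K : ℕ) : ℝ) / M ≤ ((M * j / K : ℕ) : ℝ) / M + 1 / K + 1 / M := by
      have g1 : ((M * (j + 1) / K : ℕ) : ℝ) ≤ ((M * (j + 1) : ℕ) : ℝ) / K := Nat.cast_div_le
      have g2 : ((M * j : ℕ) : ℝ) / K ≤ ((M * j / K : ℕ) : ℝ) + 1 := by
        rw [div_le_iff₀ hKr]
        have := (Nat.lt_mul_div_succ (M * j) hK).le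
        rw [mul_comm K] at this
        exact_mod_cast this
      have g3 : ((M * (j + 1) : ℕ) : ℝ) / K = ((M * j : ℕ) : ℝ) / K + M / K := by
        push_cast
        ring
      calc _ ≤ (((M * j / K : ℕ) : ℝ) + 1 + M / K) / M := by gcongr; linarith
        _ = _ := by field_simp; ring
    have hlo' : ((M * j / K : ℕ) : ℝ) / M ≤ (i : ℝ) / M := by gcongr
    have hhi' : (i : ℝ) / M ≤ ((M * (j + 1) / K : ℕ) : ℝ) / M := by gcongr
    have b1 := abs_le.1 (h j (by omega))
    have b2 := abs_le.1 (h (j + 1) hjK)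
    have m1 := hmono hlo
    have m2 := hmono hhi
    have n1 : q * ((i : ℝ) / M - ((M * j / K : ℕ) : ℝ) / M) ≤ 1 / K + 1 / M :=
      (mul_le_of_le_one_left (by linarith) hq1).trans (by linarith)
    have n2 : q * (((M * (j + 1) / K : ℕ) : ℝ) / M - (i : ℝ) / M) ≤ 1 / K + 1 / M :=
      (mul_le_of_le_one_left (by linarith) hq1).trans (by linarith)
    rw [abs_le]
    constructor <;> linarith
  · have := h K le_rfl
    rw [Nat.mul_div_cancel _ hK] at this
    linarith

/-- The rescaled partial sums of `Q` along `σ⁻¹` deviate from linear growth by more than `ε`. -/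
def Deviates {M : ℕ} (Q : Fin M → ℝ) (ε : ℝ) (σ : Equiv.Perm (Fin M)) : Prop :=
  ∃ i ≤ M, ε < |cumsum Q σ⁻¹ i - (∑ w, Q w) * ((i : ℝ) / M)|

open Classical in
lemma sum_deviates_le {M K : ℕ} (hM : 0 < M) (hK : 0 < K) {Q : Fin M → ℝ} (hQ : ∀ w, 0 ≤ Q w)
    (hq1 : ∑ w, Q w ≤ 1) {b δ : ℝ} (hb : ∀ w, Q w ≤ b) (hb0 : 0 ≤ b) (hδ : 0 < δ) :
    ∑ σ : Equiv.Perm (Fin M), (if Deviates Q (δ + 1 / K + 1 / M) σ then (1 : ℝ) else 0)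
      ≤ M.factorial * ((K + 1) * b / δ ^ 2) := by
  set q := ∑ w, Q w with hq
  have hsq : ∑ w, Q w ^ 2 ≤ b := by
    calc _ ≤ ∑ w, b * Q w := Finset.sum_le_sum fun w _ => by nlinarith [hQ w, hb w]
      _ = b * q := by rw [← Finset.mul_sum]
      _ ≤ b := mul_le_of_le_one_right hb0 hq1
  have hpt (σ : Equiv.Perm (Fin M)) : (if Deviates Q (δ + 1 / K + 1 / M) σ then (1 : ℝ) else 0)
      ≤ ∑ j ∈ Finset.range (K + 1),
        (cumsum Q σ⁻¹ (M * j / K) - q * (((M * j / K : ℕ) : ℝ) / M)) ^ 2 / δ ^ 2 := by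
    split_ifs with hdev
    · obtain ⟨i, hi, hlt⟩ := hdev
      have : ∃ j ≤ K, δ < |cumsum Q σ⁻¹ (M * j / K) - q * (((M * j / K : ℕ) : ℝ) / M)| := by
        by_contra! hc
        exact hlt.not_ge (abs_sub_le_of_grid hM hK (cumsum_mono_s18 hQ _) hq1 hc hi)
      obtain ⟨j, hj, hlt⟩ := this
      refine le_trans ?_ (Finset.single_le_sum (fun _ _ => by positivity)
        (Finset.mem_range.2 (Nat.lt_succ_of_le hj)))
      rw [one_le_div (by positivity), ← sq_abs (_ - _)]
      gcongr
    · exact Finset.sum_nonneg fun _ _ => by positivity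
  calc _ ≤ _ := Finset.sum_le_sum fun σ _ => hpt σ
    _ = ∑ j ∈ Finset.range (K + 1), (∑ σ : Equiv.Perm (Fin M),
        (cumsum Q σ⁻¹ (M * j / K) - q * (((M * j / K : ℕ) : ℝ) / M)) ^ 2) / δ ^ 2 := by
      rw [Finset.sum_comm]
      simp only [Finset.sum_div]
    _ ≤ ∑ j ∈ Finset.range (K + 1), (M.factorial * b) / δ ^ 2 := by
      refine Finset.sum_le_sum fun j hj => ?_
      have hj' : M * j / K ≤ M := by
        apply Nat.div_le_of_le_mul
        rw [mul_comm]
        exact Nat.mul_le_mul_right _ (Nat.lt_succ_iff.1 (Finset.mem_range.1 hj))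
      have := sum_perm_sq_cumsum_sub_le hM Q hj'
      gcongr
      exact this.trans (by gcongr)
    _ = _ := by
      simp
      ring

lemma eta_mem_Icc {M : ℕ} (i : Fin M) : eta M i ∈ Set.Icc (0 : ℝ) 1 := by
  have hi : ((i : ℕ) : ℝ) + 1 ≤ M := by exact_mod_cast i.isLt
  have hi0 : (0 : ℝ) ≤ (i : ℕ) := by positivity
  unfold eta
  exact ⟨div_nonneg hi0 (by linarith), div_le_one_of_le₀ (by linarith) (by linarith)⟩

/-- The average of `windowLength s` over the normalized indices. -/
noncomputable def gridAverage (s : ℝ) (M : ℕ) : ℝ :=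
  (1 / (M : ℝ)) * ∑ i : Fin M, windowLength s (eta M i)

lemma abs_gridAverage_sub_le (s t : ℝ) {M : ℕ} (hM : 0 < M) :
    |gridAverage s M - gridAverage t M| ≤ 2 * |s - t| := by
  have hM' : (0 : ℝ) < M := by exact_mod_cast hM
  unfold gridAverage
  rw [← mul_sub, ← Finset.sum_sub_distrib, abs_mul, abs_of_pos (by positivity)]
  calc _ ≤ 1 / (M : ℝ) * ∑ i : Fin M, 2 * |s - t| := by
        gcongr
        exact (Finset.abs_sum_le_sum_abs _ _).trans
          (Finset.sum_le_sum fun i _ => abs_windowLength_sub_le s t _)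
    _ = _ := by
      simp
      field_simp

lemma sum_windowLength_perm_div_factorial {M : ℕ} (w : Fin M) (s : ℝ) :
    (∑ σ : Equiv.Perm (Fin M), windowLength s (eta M (σ w))) / M.factorial = gridAverage s M := by
  have hM : (M : ℝ) ≠ 0 := by
    have := w.pos
    positivity
  have hf : (M.factorial : ℝ) ≠ 0 := by positivity
  have := card_mul_sum_perm_apply (fun i => windowLength s (eta M i)) w
  rw [Fintype.card_fin] at this
  unfold gridAverage
  field_simp
  linarith

lemma cumsum_lt_of_isLeast {M : ℕ} {P : Fin M → ℝ} {σ : Equiv.Perm (Fin M)} {u : ℝ} {k : Fin M}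
    (hu : 0 < u) (hk : IsLeast {i : Fin M | u ≤ cumsum P σ ((i : ℕ) + 1)} k) :
    cumsum P σ k < u := by
  by_contra! hc
  have hk0 : (k : ℕ) ≠ 0 := by
    intro h0
    rw [h0] at hc
    have : cumsum P σ 0 = 0 := by simp [cumsum]
    linarith
  have hlt : (k : ℕ) - 1 < M := by omega
  have : (⟨(k : ℕ) - 1, hlt⟩ : Fin M) ∈ {i : Fin M | u ≤ cumsum P σ ((i : ℕ) + 1)} := by
    simpa [Nat.sub_add_cancel (Nat.pos_of_ne_zero hk0)] using hc
  have := Fin.le_def.1 (hk.2 this)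
  simp at this
  omega

lemma abs_toReal_sub_le_of_compl {Ω : Type*} [MeasurableSpace Ω] (μ : Measure Ω)
    [IsProbabilityMeasure μ] {T : Set Ω} {a e : ℝ} (h0 : 0 ≤ a + e) (h1 : 0 ≤ 1 - a + e)
    (hT : μ T ≤ ENNReal.ofReal (a + e)) (hTc : μ Tᶜ ≤ ENNReal.ofReal (1 - a + e)) :
    |(μ T).toReal - a| ≤ e := by
  have t1 := ENNReal.toReal_le_of_le_ofReal h0 hT
  have t2 := ENNReal.toReal_le_of_le_ofReal h1 hTc
  have t3 : 1 ≤ (μ T).toReal + (μ Tᶜ).toReal := by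
    rw [← ENNReal.toReal_add (measure_ne_top _ _) (measure_ne_top _ _)]
    have : (1 : ℝ≥0∞) ≤ μ T + μ Tᶜ := by
      rw [← measure_univ (μ := μ), ← Set.union_compl_self T]
      exact measure_union_le _ _
    exact (ENNReal.toReal_one ▸ ENNReal.toReal_mono (by finiteness) this)
  rw [abs_le]
  constructor <;> linarith

instance isProbabilityMeasure_unifMeasure : IsProbabilityMeasure unifMeasure :=
  ⟨by simp [unifMeasure]⟩

instance isProbabilityMeasure_permUnif (M : ℕ) : IsProbabilityMeasure (permUnif M) := by
  unfold permUnif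
  infer_instance

lemma abs_prob_sub_gridAverage_le {M K : ℕ} (hM : 2 ≤ M) (hK : 0 < K) {P : Fin M → ℝ}
    (hP0 : ∀ w, 0 ≤ P w) (hP1 : ∑ w, P w = 1) {kf : Equiv.Perm (Fin M) → ℝ → Fin M}
    (hk : ∀ (σ : Equiv.Perm (Fin M)) (u : ℝ), 0 < u → u ≤ 1 →
      IsLeast {i : Fin M | u ≤ cumsum P σ⁻¹ ((i : ℕ) + 1)} (kf σ u))
    {w₀ : Fin M} {b : ℝ} (hb : ∀ w, w ≠ w₀ → P w ≤ b) (hb0 : 0 ≤ b) (hp : 0 < P w₀)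
    {r δ : ℝ} (hr : 0 ≤ r) (hδ : 0 < δ) :
    |(((permUnif M).prod unifMeasure)
        {q : Equiv.Perm (Fin M) × ℝ | |q.2 - eta M (kf q.1 q.2)| ≤ r}).toReal
      - gridAverage (r / P w₀) M|
      ≤ 10 * ((δ + 1 / K + 1 / M + 1 / M) / P w₀) + (K + 1) * b / δ ^ 2 := by
  classical
  have hM0 : 0 < M := by omega
  set p := P w₀ with hpdef
  set Q := dropAtom P w₀ with hQdef
  set s := r / p with hs
  set ε : ℝ := δ + 1 / K + 1 / M with hε
  set d := (ε + 1 / M) / p with hd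
  have hs0 : 0 ≤ s := by positivity
  have hd0 : 0 ≤ d := by positivity
  have hps : p * s = r := mul_div_cancel₀ _ hp.ne'
  have hpd : p * d = ε + 1 / M := mul_div_cancel₀ _ hp.ne'
  have hQ0 : ∀ w, 0 ≤ Q w := dropAtom_nonneg hP0 w₀
  have hpq : p + ∑ w, Q w = 1 := by rw [hpdef, hQdef, add_sum_dropAtom, hP1]
  have hq0 : 0 ≤ ∑ w, Q w := Finset.sum_nonneg fun w _ => hQ0 w
  have hq1 : ∑ w, Q w ≤ 1 := by linarith
  have hQb (w : Fin M) : Q w ≤ b := by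
    rw [hQdef]
    unfold dropAtom
    split_ifs with h
    exacts [hb0, hb w h]
  have hdev := sum_deviates_le hM0 hK hQ0 hq1 hQb hb0 hδ
  have hregions {σ : Equiv.Perm (Fin M)} (hσ : ¬ Deviates Q ε σ) (u : ℝ) (hu0 : 0 < u)
      (hu1 : u < 1) :
      AtomRegions p (∑ w, Q w) (eta M (σ w₀)) (p * d) (eta M (kf σ u)) u := by
    have hleast := hk σ u hu0 hu1.le
    have h1 := cumsum_lt_of_isLeast hu0 hleast
    have h2 : u ≤ _ := hleast.1
    rw [cumsum_eq_dropAtom P w₀] at h1 h2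
    unfold Deviates at hσ
    push Not at hσ
    rw [hpd]
    exact atomRegions_of_cumulative hM (cumsum_mono_s18 hQ0 _) hq0 hq1 hσ _ _ h1 h2
  set I : Equiv.Perm (Fin M) → ℝ := fun σ => if Deviates Q ε σ then 1 else 0 with hI
  have hI0 (σ : Equiv.Perm (Fin M)) : 0 ≤ I σ := by
    rw [hI]
    positivity
  have hW0 (σ : Equiv.Perm (Fin M)) : 0 ≤ windowLength s (eta M (σ w₀)) :=
    windowLength_nonneg hs0 (eta_mem_Icc _).1 (eta_mem_Icc _).2
  have hW1 (σ : Equiv.Perm (Fin M)) := windowLength_le_one s (eta M (σ w₀))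
  have hfac : (0 : ℝ) < M.factorial := by positivity
  have hIavg : (∑ σ, I σ) / M.factorial ≤ (K + 1) * b / δ ^ 2 := by
    rw [div_le_iff₀ hfac, mul_comm]
    exact hdev
  have hWavg := sum_windowLength_perm_div_factorial w₀ s
  have hconst (c : ℝ) : (∑ _σ : Equiv.Perm (Fin M), c) / M.factorial = c := by
    rw [Finset.sum_const, Finset.card_univ, Fintype.card_perm, Fintype.card_fin, nsmul_eq_mul]
    field_simp
  have hone {S : Set ℝ} {B : ℝ} (hB : 1 ≤ B) : unifMeasure S ≤ ENNReal.ofReal B :=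
    prob_le_one.trans (by simpa using hB)
  have hup := permUnif_prod_le
    (T := {q : Equiv.Perm (Fin M) × ℝ | |q.2 - eta M (kf q.1 q.2)| ≤ r})
    (B := fun σ => windowLength s (eta M (σ w₀)) + 10 * d + I σ)
    (fun σ => by linarith [hI0 σ, hW0 σ]) (fun σ => by
      by_cases hσ : Deviates Q ε σ
      · refine hone ?_
        simp only [hI, if_pos hσ]
        linarith [hW0 σ]
      · simp only [hI, if_neg hσ, add_zero, ← hps]
        exact unifMeasure_abs_sub_le_le hp hq0 hpq hs0 hd0 (eta_mem_Icc _).1 (eta_mem_Icc _).2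
          (x := fun u => eta M (kf σ u)) (hregions hσ))
  have hlow := permUnif_prod_le
    (T := {q : Equiv.Perm (Fin M) × ℝ | |q.2 - eta M (kf q.1 q.2)| ≤ r}ᶜ)
    (B := fun σ => 1 - windowLength s (eta M (σ w₀)) + 10 * d + I σ)
    (fun σ => by linarith [hI0 σ, hW1 σ]) (fun σ => by
      by_cases hσ : Deviates Q ε σ
      · refine hone ?_
        simp only [hI, if_pos hσ]
        linarith [hW1 σ]
      · simp only [hI, if_neg hσ, add_zero, ← hps, Set.mem_compl_iff, Set.mem_ofPred_eq, not_le]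
        exact unifMeasure_lt_abs_sub_le hp hq0 hpq hs0 hd0 (fun _ => (eta_mem_Icc _).1)
          (fun _ => (eta_mem_Icc _).2) (x := fun u => eta M (kf σ u)) (hregions hσ))
  simp only [Finset.sum_add_distrib, Finset.sum_sub_distrib, add_div, sub_div, hconst,
    hWavg] at hup hlow
  have hG0 : 0 ≤ gridAverage s M := by
    rw [← hWavg]
    exact div_nonneg (Finset.sum_nonneg fun σ _ => hW0 σ) hfac.le
  have hG1 : gridAverage s M ≤ 1 := by
    rw [← hWavg, ← hconst 1]
    exact div_le_div_of_nonneg_right (Finset.sum_le_sum fun σ _ => hW1 σ) hfac.le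
  have hb' : 0 ≤ (K + 1) * b / δ ^ 2 := by positivity
  refine abs_toReal_sub_le_of_compl _ (by linarith) (by linarith)
    (hup.trans (ENNReal.ofReal_le_ofReal (by linarith)))
    (hlow.trans (ENNReal.ofReal_le_ofReal (by linarith)))

lemma tendsto_zero_of_log_mul {f : ℕ → ℝ}
    (h : Tendsto (fun M : ℕ => Real.log M * f M) atTop (nhds 0)) : Tendsto f atTop (nhds 0) := by
  have hlog : Tendsto (fun M : ℕ => Real.log M) atTop atTop :=
    Real.tendsto_log_atTop.comp tendsto_natCast_atTop_atTop
  have := hlog.inv_tendsto_atTop.mul h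
  rw [mul_zero] at this
  refine this.congr' ?_
  filter_upwards [hlog.eventually_gt_atTop 0] with M hM
  simp only [Pi.inv_apply]
  field_simp

/-- Large-vocabulary limits for the inverse-transform watermark statistic
`Y^dif = |U - η(k(π,U))|`: (i) the null CDF converges to `1-(1-r)²`; (ii) if the
top probability tends to `1-Δ` and the second-largest probability is `o(1/log M)`,
the alternative CDF converges to `1-(1-r/(1-Δ))²` on `[0, 1-Δ]`. -/
theorem inverse_transform_asymptotics :
    (∀ r ∈ Set.Icc (0:ℝ) 1,
      Tendsto (fun M : ℕ => (1 / (M : ℝ)) *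
          ∑ i : Fin M, (min ((i : ℕ) / ((M : ℝ) - 1) + r) 1
            - max ((i : ℕ) / ((M : ℝ) - 1) - r) 0))
        atTop (nhds (1 - (1 - r) ^ 2)))
    ∧ (∀ Δ : ℝ, 0 ≤ Δ → Δ < 1 →
      ∀ (P : (M : ℕ) → Fin M → ℝ)
        (kfun : (M : ℕ) → Equiv.Perm (Fin M) → ℝ → Fin M)
        (p1 p2 : ℕ → ℝ),
        (∀ M : ℕ, 2 ≤ M → (∀ w, 0 ≤ P M w) ∧ ∑ w, P M w = 1) →
        (∀ M : ℕ, 2 ≤ M → ∀ (σ : Equiv.Perm (Fin M)) (u : ℝ), 0 < u → u ≤ 1 →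
          IsLeast {i : Fin M | u ≤ cumsum (P M) σ⁻¹ ((i : ℕ) + 1)} (kfun M σ u)) →
        (∀ M : ℕ, 2 ≤ M → ∃ w0 : Fin M,
          (∀ w, P M w ≤ p1 M) ∧ P M w0 = p1 M ∧
          (∀ w, w ≠ w0 → P M w ≤ p2 M) ∧ (∃ w, w ≠ w0 ∧ P M w = p2 M)) →
        Tendsto p1 atTop (nhds (1 - Δ)) →
        Tendsto (fun M : ℕ => Real.log M * p2 M) atTop (nhds 0) →
        ∀ r ∈ Set.Icc (0:ℝ) (1 - Δ),
          Tendsto (fun M : ℕ => ((permUnif M).prod unifMeasure)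
              {q : Equiv.Perm (Fin M) × ℝ | |q.2 - eta M (kfun M q.1 q.2)| ≤ r})
            atTop (nhds (ENNReal.ofReal (1 - (1 - r / (1 - Δ)) ^ 2)))) := by
  refine ⟨fun r hr => ?_, fun Δ hΔ0 hΔ1 P kfun p1 p2 hP hk hp12 hp1 hp2 r hr => ?_⟩
  · simpa only [windowLength_eq] using tendsto_grid_average_windowLength hr
  have hpos : 0 < 1 - Δ := by linarith
  replace hp2 := tendsto_zero_of_log_mul hp2
  set s := r / (1 - Δ) with hs
  set t : ℕ → ℝ := fun M => (((permUnif M).prod unifMeasure)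
    {q : Equiv.Perm (Fin M) × ℝ | |q.2 - eta M (kfun M q.1 q.2)| ≤ r}).toReal with ht
  suffices Tendsto t atTop (nhds (1 - (1 - s) ^ 2)) by
    refine (ENNReal.tendsto_ofReal this).congr fun M => ?_
    exact ENNReal.ofReal_toReal (measure_ne_top _ _)
  have hgrid : Tendsto (gridAverage s) atTop (nhds (1 - (1 - s) ^ 2)) :=
    tendsto_grid_average_windowLength ⟨div_nonneg hr.1 hpos.le, div_le_one_of_le₀ hr.2 hpos.le⟩
  have hMi : Tendsto (fun M : ℕ => 1 / (M : ℝ)) atTop (nhds 0) :=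
    tendsto_one_div_atTop_nhds_zero_nat
  have hdiff : Tendsto (fun M => t M - gridAverage s M) atTop (nhds 0) := by
    rw [Metric.tendsto_atTop']
    intro ε hε
    obtain ⟨K, hK0, hK⟩ : ∃ K : ℕ, 0 < K ∧ 10 * ((1 / (K : ℝ) + 1 / K) / (1 - Δ)) < ε := by
      have : Tendsto (fun K : ℕ => 10 * ((1 / (K : ℝ) + 1 / K) / (1 - Δ))) atTop
          (nhds (10 * ((0 + 0) / (1 - Δ)))) := ((hMi.add hMi).div_const _).const_mul 10
      simp only [add_zero, zero_div, mul_zero] at this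
      exact ((eventually_gt_atTop 0).and (this.eventually_lt_const hε)).exists
    have herr : Tendsto (fun M : ℕ => 10 * ((1 / (K : ℝ) + 1 / K + 1 / M + 1 / M) / p1 M)
        + (K + 1) * p2 M / (1 / (K : ℝ)) ^ 2 + 2 * |r / p1 M - s|) atTop
        (nhds (10 * ((1 / (K : ℝ) + 1 / K + 0 + 0) / (1 - Δ))
          + (K + 1) * 0 / (1 / (K : ℝ)) ^ 2 + 2 * |r / (1 - Δ) - s|)) := by
      refine ((Tendsto.const_mul 10 ?_).add ?_).add (Tendsto.const_mul 2 ?_)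
      · exact ((hMi.const_add _).add hMi).div hp1 hpos.ne'
      · exact (hp2.const_mul _).div_const _
      · exact ((tendsto_const_nhds.div hp1 hpos.ne').sub_const s).abs
    simp only [add_zero, mul_zero, zero_div, ← hs, sub_self, abs_zero] at herr
    obtain ⟨N, hN⟩ := eventually_atTop.1 ((herr.eventually_lt_const hK).and
      ((hp1.eventually_const_lt hpos).and (eventually_ge_atTop 2)))
    refine ⟨N, fun M hM => ?_⟩
    obtain ⟨h1, h2, h3⟩ := hN M hM.le
    obtain ⟨w₀, -, hw₀, hother, w, hw, hwp2⟩ := hp12 M h3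
    have hb0 : 0 ≤ p2 M := hwp2 ▸ (hP M h3).1 w
    have hKr : (0 : ℝ) < K := by exact_mod_cast hK0
    have hest := abs_prob_sub_gridAverage_le h3 hK0 (hP M h3).1 (hP M h3).2 (hk M h3) hother hb0
      (hw₀ ▸ h2) hr.1 (δ := 1 / K) (by positivity)
    rw [hw₀] at hest
    have hgap := abs_gridAverage_sub_le (r / p1 M) s (show 0 < M by omega)
    rw [Real.dist_eq, sub_zero]
    exact (abs_sub_le _ (gridAverage (r / p1 M) M) _).trans_lt
      ((add_le_add hest hgap).trans_lt h1)
  have := hdiff.add hgrid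
  rw [zero_add] at this
  exact this.congr fun M => sub_add_cancel _ _
end
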